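/- arXiv:2004.03432 — 4 statements merged into one kernel-verified Lean document; each statement's English description precedes it below -/
import Mathlib

section
/- Let λ, λ₁, λ₂ ∈ ℝ with λ₁ + λ₂ = λ, let 0 < θ < 1, and let Φ(t) = t^p (log(e+t))^{λ₁} where either p > 1 and λ₁ ∈ ℝ, or p = 1 and λ₁ ≥ 0. Then for every f ∈ L¹(ν), the dyadic Besov energy ‖f‖^p_{Ḃ^{θ,λ}_p} is finite if and only if the Orlicz dyadic energy |f|_{Ḃ^{θ,λ₂}_Φ} is finite. -/
open MeasureTheory ENNReal NNReal

noncomputable section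

abbrev Bd (K : ℕ) := ℕ → Fin K

def cyl {K n : ℕ} (w : Fin n → Fin K) : Set (Bd K) := {ξ | ∀ i : Fin n, ξ i = w i}

noncomputable def cylAvg {K : ℕ} (ν : Measure (Bd K)) (f : Bd K → ℝ) {n : ℕ}
    (w : Fin n → Fin K) : ℝ :=
  (ν (cyl w)).toReal⁻¹ * ∫ x in cyl w, f x ∂ν

noncomputable def besovEnergy {K : ℕ} (ν : Measure (Bd K)) (ε θ p lam : ℝ)
    (f : Bd K → ℝ) : ℝ≥0∞ :=
  ∑' n : ℕ, ENNReal.ofReal (Real.exp (ε * ((n : ℝ) + 1) * θ * p) * ((n : ℝ) + 1) ^ lam *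
    ∑ w : Fin (n + 1) → Fin K,
      (ν (cyl w)).toReal * |cylAvg ν f w - cylAvg ν f (Fin.init w)| ^ p)

noncomputable def orliczEnergy {K : ℕ} (ν : Measure (Bd K)) (Φ : ℝ → ℝ) (ε θ p lam2 : ℝ)
    (f : Bd K → ℝ) : ℝ≥0∞ :=
  ∑' n : ℕ, ENNReal.ofReal (Real.exp (ε * ((n : ℝ) + 1) * (θ - 1) * p) * ((n : ℝ) + 1) ^ lam2 *
    ∑ w : Fin (n + 1) → Fin K,
      (ν (cyl w)).toReal *
        Φ (Real.exp (ε * ((n : ℝ) + 1)) * |cylAvg ν f w - cylAvg ν f (Fin.init w)|))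

noncomputable def Phi (p lam1 : ℝ) (t : ℝ) : ℝ := t ^ p * Real.log (Real.exp 1 + t) ^ lam1

noncomputable def luxNorm {α : Type*} [MeasurableSpace α] (μ : Measure α) (Φ : ℝ → ℝ)
    (u : α → ℝ) : ℝ≥0∞ :=
  ⨅ (k : ℝ≥0) (_ : 0 < k) (_ : ∫⁻ x, ENNReal.ofReal (Φ (|u x| / k)) ∂μ ≤ 1), (k : ℝ≥0∞)

def MemLPhi {α : Type*} [MeasurableSpace α] (μ : Measure α) (Φ : ℝ → ℝ) (u : α → ℝ) : Prop :=
  AEStronglyMeasurable u μ ∧ ∃ α₀ : ℝ, 0 < α₀ ∧ ∫⁻ x, ENNReal.ofReal (Φ (α₀ * |u x|)) ∂μ < ⊤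

noncomputable def orliczSemi {K : ℕ} (ν : Measure (Bd K)) (Φ : ℝ → ℝ) (ε θ p lam2 : ℝ)
    (f : Bd K → ℝ) : ℝ≥0∞ :=
  ⨅ (k : ℝ≥0) (_ : 0 < k)
    (_ : orliczEnergy ν Φ ε θ p lam2 (fun x => f x / k) ≤ 1), (k : ℝ≥0∞)

end

open MeasureTheory ENNReal NNReal

/-- On `[m, M]` with `0 < m`, a real power is bounded by the sum of its endpoint values. -/
lemma rpow_le_of_mem_Icc {m M r : ℝ} (s : ℝ) (hm : 0 < m) (hmr : m ≤ r) (hrM : r ≤ M) :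
    r ^ s ≤ m ^ s + M ^ s := by
  have hr : 0 < r := hm.trans_le hmr
  have hM : 0 < M := hr.trans_le hrM
  rcases le_total 0 s with hs | hs
  · have := Real.rpow_le_rpow hr.le hrM hs
    have := Real.rpow_nonneg hm.le s
    linarith
  · have := Real.rpow_le_rpow_of_nonpos hm hmr hs
    have := Real.rpow_nonneg hM.le s
    linarith

lemma summable_exp_mul_rpow {c : ℝ} (hc : 0 < c) (s : ℝ) :
    Summable fun n : ℕ => Real.exp (-(c * ((n : ℝ) + 1))) * ((n : ℝ) + 1) ^ s := by
  obtain ⟨k, hk⟩ := exists_nat_ge s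
  have h := (_root_.summable_nat_add_iff 1).2 (Real.summable_pow_mul_exp_neg_nat_mul k hc)
  refine Summable.of_nonneg_of_le (fun n => by positivity) (fun n => ?_) h
  have hN : (1 : ℝ) ≤ (n : ℝ) + 1 := by linarith [n.cast_nonneg (α := ℝ)]
  have h1 : ((n : ℝ) + 1) ^ s ≤ ((n : ℝ) + 1) ^ k := by
    rw [← Real.rpow_natCast]
    exact Real.rpow_le_rpow_of_exponent_le hN hk
  push_cast
  rw [mul_comm, neg_mul]
  gcongr

/-- The size of the logarithm in `Phi` at scale `N`. -/
lemma log_exp_one_add_bounds {ε D N a : ℝ} (hε : 0 < ε) (hD : 0 ≤ D) (hN : 1 ≤ N)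
    (ha : 0 ≤ a) (haD : a ≤ Real.exp (D * N)) :
    1 ≤ Real.log (Real.exp 1 + Real.exp (ε * N) * a) ∧
      Real.log (Real.exp 1 + Real.exp (ε * N) * a) ≤ (2 + ε + D) * N := by
  constructor
  · rw [Real.le_log_iff_exp_le (by positivity)]
    have : 0 ≤ Real.exp (ε * N) * a := by positivity
    linarith
  · rw [Real.log_le_iff_le_exp (by positivity)]
    have h1 : Real.exp (ε * N) * a ≤ Real.exp (1 + (ε + D) * N) := by
      calc Real.exp (ε * N) * a ≤ Real.exp (ε * N) * Real.exp (D * N) := by gcongr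
        _ = Real.exp ((ε + D) * N) := by rw [← Real.exp_add]; ring_nf
        _ ≤ _ := Real.exp_le_exp.2 (by linarith)
    have h2 : Real.exp 1 ≤ Real.exp (1 + (ε + D) * N) := Real.exp_le_exp.2 (by
      have : 0 ≤ (ε + D) * N := by positivity
      linarith)
    calc _ ≤ 2 * Real.exp (1 + (ε + D) * N) := by linarith
      _ ≤ Real.exp 1 * Real.exp (1 + (ε + D) * N) := by
        gcongr
        linarith [Real.add_one_le_exp (1 : ℝ)]
      _ = Real.exp (2 + (ε + D) * N) := by rw [← Real.exp_add]; ring_nf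
      _ ≤ _ := Real.exp_le_exp.2 (by nlinarith)

/-- The weight of an oscillation `a` at level `N` in the Orlicz energy. -/
lemma exp_mul_rpow_mul_Phi {ε θ p lam1 lam2 N a : ℝ} (ha : 0 ≤ a) :
    Real.exp (ε * N * (θ - 1) * p) * N ^ lam2 * Phi p lam1 (Real.exp (ε * N) * a) =
      Real.exp (ε * N * θ * p) * N ^ lam2 * a ^ p *
        Real.log (Real.exp 1 + Real.exp (ε * N) * a) ^ lam1 := by
  have h : Real.exp (ε * N * θ * p) =
      Real.exp (ε * N * (θ - 1) * p) * Real.exp (ε * N) ^ p := by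
    rw [← Real.exp_mul, ← Real.exp_add]
    ring_nf
  rw [Phi, Real.mul_rpow (Real.exp_pos _).le ha, h]
  ring

/-- Pointwise comparison of the Besov and Orlicz weights, up to a summable error. -/
lemma exists_weight_comparison {ε θ p D : ℝ} (lam1 lam2 : ℝ) (hε : 0 < ε) (hp : 0 < p)
    (hθ1 : θ < 1) (hD : 0 ≤ D) :
    ∃ (C : ℝ) (R : ℕ → ℝ), 0 ≤ C ∧ (∀ n, 0 ≤ R n) ∧ Summable R ∧
      ∀ (n : ℕ) (a : ℝ), 0 ≤ a → a ≤ Real.exp (D * ((n : ℝ) + 1)) →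
        Real.exp (ε * ((n : ℝ) + 1) * θ * p) * ((n : ℝ) + 1) ^ (lam1 + lam2) * a ^ p ≤
          C * (Real.exp (ε * ((n : ℝ) + 1) * (θ - 1) * p) * ((n : ℝ) + 1) ^ lam2 *
            Phi p lam1 (Real.exp (ε * ((n : ℝ) + 1)) * a)) + R n ∧
        Real.exp (ε * ((n : ℝ) + 1) * (θ - 1) * p) * ((n : ℝ) + 1) ^ lam2 *
            Phi p lam1 (Real.exp (ε * ((n : ℝ) + 1)) * a) ≤
          C * (Real.exp (ε * ((n : ℝ) + 1) * θ * p) * ((n : ℝ) + 1) ^ (lam1 + lam2) * a ^ p)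
            + R n := by
  set δ : ℝ := (1 - θ) / 2 with hδ
  have hδ0 : 0 < δ := by rw [hδ]; linarith
  have hm : 0 < ε * δ := by positivity
  set M : ℝ := 2 + ε + D with hMdef
  have hM : 0 < M := by positivity
  have hM1 : 1 ≤ M := by linarith
  set c : ℝ := ε * p * δ with hcdef
  have hc : 0 < c := by positivity
  set C : ℝ := ((ε * δ) ^ lam1 + M ^ lam1) + ((ε * δ) ^ (-lam1) + M ^ (-lam1)) with hCdef
  have hC : 0 ≤ C := by positivity
  set R : ℕ → ℝ := fun n =>
    Real.exp (-(c * ((n : ℝ) + 1))) * ((n : ℝ) + 1) ^ (lam1 + lam2) +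
      M ^ |lam1| * (Real.exp (-(c * ((n : ℝ) + 1))) * ((n : ℝ) + 1) ^ (lam2 + |lam1|)) with hR
  refine ⟨C, R, hC, fun n => by positivity,
    (summable_exp_mul_rpow hc _).add ((summable_exp_mul_rpow hc _).mul_left _), ?_⟩
  intro n a ha haD
  have hR0 : 0 ≤ R n := by positivity
  simp only [exp_mul_rpow_mul_Phi ha]
  have hN : (1 : ℝ) ≤ (n : ℝ) + 1 := by linarith [n.cast_nonneg (α := ℝ)]
  simp only [hR] at hR0 ⊢
  generalize (n : ℝ) + 1 = N at *
  obtain ⟨hL1, hLM⟩ := log_exp_one_add_bounds hε hD hN ha haD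
  set L := Real.log (Real.exp 1 + Real.exp (ε * N) * a) with hL
  have hN0 : 0 < N := by linarith
  have hL0 : 0 < L := by linarith
  rw [Real.rpow_add hN0] at hR0 ⊢
  rcases le_total (Real.exp (-(ε * N * (1 - δ)))) a with hbig | hsmall
  · have hLm : ε * δ * N ≤ L := by
      rw [hL, Real.le_log_iff_exp_le (by positivity)]
      have : Real.exp (ε * δ * N) ≤ Real.exp (ε * N) * a := by
        calc Real.exp (ε * δ * N) = Real.exp (ε * N) * Real.exp (-(ε * N * (1 - δ))) := by
              rw [← Real.exp_add]; ring_nf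
          _ ≤ _ := by gcongr
      linarith [Real.exp_pos 1]
    have hr1 : ε * δ ≤ L / N := by rwa [le_div_iff₀ hN0]
    have hr2 : L / N ≤ M := by rwa [div_le_iff₀ hN0]
    have h1 : (L / N) ^ lam1 ≤ C :=
      (rpow_le_of_mem_Icc lam1 hm hr1 hr2).trans (le_add_of_nonneg_right (by positivity))
    have h2 : (L / N) ^ (-lam1) ≤ C :=
      (rpow_le_of_mem_Icc (-lam1) hm hr1 hr2).trans (le_add_of_nonneg_left (by positivity))
    rw [Real.div_rpow hL0.le hN0.le, div_le_iff₀ (by positivity)] at h1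
    rw [Real.rpow_neg (by positivity), Real.div_rpow hL0.le hN0.le, inv_div,
      div_le_iff₀ (by positivity)] at h2
    have hW : 0 ≤ Real.exp (ε * N * θ * p) * N ^ lam2 * a ^ p := by positivity
    constructor
    · nlinarith [mul_le_mul_of_nonneg_left h2 hW]
    · nlinarith [mul_le_mul_of_nonneg_left h1 hW]
  · have hap : Real.exp (ε * N * θ * p) * a ^ p ≤ Real.exp (-(c * N)) := by
      calc Real.exp (ε * N * θ * p) * a ^ p
          ≤ Real.exp (ε * N * θ * p) * Real.exp (-(ε * N * (1 - δ))) ^ p := by gcongr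
        _ = Real.exp (-(c * N)) := by
          rw [← Real.exp_mul, ← Real.exp_add, hcdef, hδ]; ring_nf
    have hLp : L ^ lam1 ≤ M ^ |lam1| * N ^ |lam1| := by
      rw [← Real.mul_rpow hM.le hN0.le]
      exact (Real.rpow_le_rpow_of_exponent_le hL1 (le_abs_self _)).trans
        (Real.rpow_le_rpow hL0.le hLM (abs_nonneg _))
    constructor
    · calc Real.exp (ε * N * θ * p) * (N ^ lam1 * N ^ lam2) * a ^ p
          = (Real.exp (ε * N * θ * p) * a ^ p) * (N ^ lam1 * N ^ lam2) := by ring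
        _ ≤ Real.exp (-(c * N)) * (N ^ lam1 * N ^ lam2) := by gcongr
        _ ≤ _ := by
          rw [← sub_nonneg]; ring_nf; positivity
    · calc Real.exp (ε * N * θ * p) * N ^ lam2 * a ^ p * L ^ lam1
          = (Real.exp (ε * N * θ * p) * a ^ p) * N ^ lam2 * L ^ lam1 := by ring
        _ ≤ Real.exp (-(c * N)) * N ^ lam2 * (M ^ |lam1| * N ^ |lam1|) := by gcongr
        _ ≤ _ := by
          rw [Real.rpow_add hN0, ← sub_nonneg]; ring_nf; positivity

lemma abs_cylAvg_le {K : ℕ} {ν : Measure (Bd K)}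
    (hν : ∀ (n : ℕ) (w : Fin n → Fin K), ν (cyl w) = ((K : ℝ≥0∞) ^ n)⁻¹)
    {f : Bd K → ℝ} (hf : Integrable f ν) {n : ℕ} (w : Fin n → Fin K) :
    |cylAvg ν f w| ≤ (K : ℝ) ^ n * ∫ x, |f x| ∂ν := by
  have h : |∫ x in cyl w, f x ∂ν| ≤ ∫ x, |f x| ∂ν :=
    (abs_integral_le_integral_abs).trans
      (setIntegral_le_integral hf.abs (Filter.Eventually.of_forall fun x => abs_nonneg _))
  have hK : (ν (cyl w)).toReal⁻¹ = (K : ℝ) ^ n := by simp [hν]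
  rw [cylAvg, hK, abs_mul, abs_of_nonneg (by positivity)]
  gcongr

lemma exists_abs_cylAvg_sub_le {K : ℕ} (hK : 2 ≤ K) {ν : Measure (Bd K)}
    (hν : ∀ (n : ℕ) (w : Fin n → Fin K), ν (cyl w) = ((K : ℝ≥0∞) ^ n)⁻¹)
    {f : Bd K → ℝ} (hf : Integrable f ν) :
    ∃ D : ℝ, 0 ≤ D ∧ ∀ (n : ℕ) (w : Fin (n + 1) → Fin K),
      |cylAvg ν f w - cylAvg ν f (Fin.init w)| ≤ Real.exp (D * ((n : ℝ) + 1)) := by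
  set I : ℝ := ∫ x, |f x| ∂ν with hI
  have hI0 : 0 ≤ I := integral_nonneg fun x => abs_nonneg _
  have hK1 : (1 : ℝ) ≤ K := by exact_mod_cast (by omega : 1 ≤ K)
  have hlog : 0 ≤ Real.log K := Real.log_nonneg hK1
  refine ⟨Real.log K + 2 * I, by positivity, fun n w => ?_⟩
  have hpow : (K : ℝ) ^ n ≤ (K : ℝ) ^ (n + 1) := pow_le_pow_right₀ hK1 n.le_succ
  have hexp : (K : ℝ) ^ (n + 1) = Real.exp (Real.log K * ((n : ℝ) + 1)) := by
    rw [Real.exp_mul, Real.exp_log (by linarith), ← Real.rpow_natCast]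
    push_cast
    rfl
  have h2I : 2 * I ≤ Real.exp (2 * I * ((n : ℝ) + 1)) := by
    have h0 : 0 ≤ 2 * I * n := by positivity
    linarith [Real.add_one_le_exp (2 * I * ((n : ℝ) + 1))]
  calc |cylAvg ν f w - cylAvg ν f (Fin.init w)|
      ≤ |cylAvg ν f w| + |cylAvg ν f (Fin.init w)| := abs_sub _ _
    _ ≤ (K : ℝ) ^ (n + 1) * I + (K : ℝ) ^ n * I :=
      add_le_add (abs_cylAvg_le hν hf w) (abs_cylAvg_le hν hf _)
    _ ≤ (K : ℝ) ^ (n + 1) * (2 * I) := by nlinarith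
    _ ≤ Real.exp (Real.log K * ((n : ℝ) + 1)) * Real.exp (2 * I * ((n : ℝ) + 1)) := by
      rw [hexp]; gcongr
    _ = _ := by rw [← Real.exp_add]; ring_nf

lemma sum_cyl_toReal {K : ℕ} (hK : K ≠ 0) {ν : Measure (Bd K)}
    (hν : ∀ (n : ℕ) (w : Fin n → Fin K), ν (cyl w) = ((K : ℝ≥0∞) ^ n)⁻¹) (n : ℕ) :
    ∑ w : Fin n → Fin K, (ν (cyl w)).toReal = 1 := by
  have : (K : ℝ) ≠ 0 := by exact_mod_cast hK
  simp [hν, this]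

/-- Averaging a termwise inequality with an additive error over a probability weight. -/
lemma mul_sum_le_of_forall_le {ι : Type*} [Fintype ι] {m u v : ι → ℝ} {s t C r : ℝ}
    (hm : ∀ i, 0 ≤ m i) (hm1 : ∑ i, m i = 1) (h : ∀ i, s * u i ≤ C * (t * v i) + r) :
    s * ∑ i, m i * u i ≤ C * (t * ∑ i, m i * v i) + r := by
  calc s * ∑ i, m i * u i = ∑ i, m i * (s * u i) := by
        rw [Finset.mul_sum]; exact Finset.sum_congr rfl fun i _ => by ring
    _ ≤ ∑ i, m i * (C * (t * v i) + r) :=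
      Finset.sum_le_sum fun i _ => mul_le_mul_of_nonneg_left (h i) (hm i)
    _ = C * (t * ∑ i, m i * v i) + (∑ i, m i) * r := by
      simp only [Finset.mul_sum, Finset.sum_mul, ← Finset.sum_add_distrib]
      exact Finset.sum_congr rfl fun i _ => by ring
    _ = _ := by rw [hm1, one_mul]

lemma tsum_ofReal_lt_top_of_le {u v R : ℕ → ℝ} {C : ℝ} (hC : 0 ≤ C) (hR0 : ∀ n, 0 ≤ R n)
    (hR : Summable R) (huv : ∀ n, u n ≤ C * v n + R n)
    (hv : ∑' n, ENNReal.ofReal (v n) < ⊤) : ∑' n, ENNReal.ofReal (u n) < ⊤ := by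
  calc ∑' n, ENNReal.ofReal (u n)
      ≤ ∑' n, (ENNReal.ofReal C * ENNReal.ofReal (v n) + ENNReal.ofReal (R n)) := by
        refine ENNReal.tsum_le_tsum fun n => ?_
        rw [← ENNReal.ofReal_mul hC]
        exact (ENNReal.ofReal_le_ofReal (huv n)).trans ENNReal.ofReal_add_le
    _ = ENNReal.ofReal C * ∑' n, ENNReal.ofReal (v n) + ENNReal.ofReal (∑' n, R n) := by
        rw [ENNReal.tsum_add, ENNReal.tsum_mul_left, ENNReal.ofReal_tsum_of_nonneg hR0 hR]
    _ < ⊤ := ENNReal.add_lt_top.2 ⟨ENNReal.mul_lt_top ENNReal.ofReal_lt_top hv,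
        ENNReal.ofReal_lt_top⟩

/-- For `f ∈ L¹(ν)`, the dyadic Besov energy `‖f‖^p_{Ḃ^{θ,λ}_p}` is finite
iff the Orlicz dyadic energy `|f|_{Ḃ^{θ,λ₂}_Φ}` is finite, where `Φ(t) = t^p log^{λ₁}(e+t)`,
`λ₁ + λ₂ = λ`, `0 < θ < 1`, and either `p > 1` or `p = 1, λ₁ ≥ 0`. -/
theorem statement1 (K : ℕ) (hK : 2 ≤ K) (ε : ℝ) (hε : 0 < ε)
    (ν : Measure (Bd K)) (hprob : IsProbabilityMeasure ν)
    (hν : ∀ (n : ℕ) (w : Fin n → Fin K), ν (cyl w) = ((K : ℝ≥0∞) ^ n)⁻¹)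
    (p lam lam1 lam2 θ : ℝ) (hp : 1 < p ∨ (p = 1 ∧ 0 ≤ lam1))
    (hlam : lam1 + lam2 = lam) (hθ0 : 0 < θ) (hθ1 : θ < 1) :
    ∀ f : Bd K → ℝ, Integrable f ν →
      (besovEnergy ν ε θ p lam f < ⊤ ↔ orliczEnergy ν (Phi p lam1) ε θ p lam2 f < ⊤) := by
  intro f hf
  subst hlam
  have hp0 : 0 < p := by rcases hp with h | h <;> linarith
  obtain ⟨D, hD, hosc⟩ := exists_abs_cylAvg_sub_le hK hν hf
  obtain ⟨C, R, hC, hR0, hR, hcomp⟩ :=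
    exists_weight_comparison (θ := θ) lam1 lam2 hε hp0 hθ1 hD
  have hsum := fun n => sum_cyl_toReal (by omega) hν n
  constructor
  · exact tsum_ofReal_lt_top_of_le hC hR0 hR fun n =>
      mul_sum_le_of_forall_le (fun _ => ENNReal.toReal_nonneg) (hsum (n + 1)) fun w =>
        (hcomp n _ (abs_nonneg _) (hosc n w)).2
  · exact tsum_ofReal_lt_top_of_le hC hR0 hR fun n =>
      mul_sum_le_of_forall_le (fun _ => ENNReal.toReal_nonneg) (hsum (n + 1)) fun w =>
        (hcomp n _ (abs_nonneg _) (hosc n w)).1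
end

section
/- Let Q = (log K)/ε. There exists a constant C ≥ 1 such that for every ξ ∈ ∂X and every real r with 0 < r ≤ 2/ε, one has C⁻¹·r^Q ≤ ν({ω ∈ ∂X : d(ξ, ω) ≤ r}) ≤ C·r^Q. In particular, (∂X, d, ν) is Ahlfors Q-regular with Hausdorff dimension Q = (log K)/ε. -/
open MeasureTheory ENNReal NNReal

open Classical in
noncomputable def treeDist {K : ℕ} (ε : ℝ) (ξ ζ : Bd K) : ℝ :=
  if ξ = ζ then 0
  else (2 / ε) * Real.exp (-(ε * (sInf {m : ℕ | ξ m ≠ ζ m} : ℕ)))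

open MeasureTheory ENNReal NNReal

open Classical in
/-- Every closed ball around `ξ` of radius `(2/ε)·exp(-ε t)` is a cylinder of length `⌈t⌉₊`. -/
theorem treeDist_closedBall_eq_cyl {K : ℕ} {ε : ℝ} (hε : 0 < ε) (ξ : Bd K) (t : ℝ) :
    {ω : Bd K | treeDist ε ξ ω ≤ 2 / ε * Real.exp (-(ε * t))} =
      cyl (fun i : Fin ⌈t⌉₊ => ξ i) := by
  have hpos : 0 < 2 / ε := by positivity
  ext ω
  simp only [Set.mem_ofPred_eq, cyl, treeDist]
  split_ifs with h
  · subst h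
    simp only [implies_true, iff_true]
    positivity
  · rw [mul_le_mul_iff_right₀ hpos, Real.exp_le_exp, neg_le_neg_iff, mul_le_mul_iff_right₀ hε,
      ← Nat.ceil_le]
    have hne : {m : ℕ | ξ m ≠ ω m}.Nonempty := Function.ne_iff.mp h
    constructor
    · intro hle i
      by_contra hi
      have hmem : (i : ℕ) ∈ {m : ℕ | ξ m ≠ ω m} := fun h' => hi h'.symm
      have := Nat.sInf_le hmem
      have := i.isLt
      omega
    · intro hω
      by_contra! hlt
      exact Nat.sInf_mem hne (hω ⟨_, hlt⟩).symm

/-- With `Q = log K / ε`, there is `C ≥ 1` such that for every `ξ ∈ ∂X` and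
every `0 < r ≤ 2/ε`, `C⁻¹ r^Q ≤ ν(B(ξ,r)) ≤ C r^Q`, i.e. `(∂X, d, ν)` is Ahlfors
`Q`-regular with Hausdorff dimension `Q = log K / ε`. -/
theorem statement5 (K : ℕ) (hK : 2 ≤ K) (ε : ℝ) (hε : 0 < ε)
    (ν : Measure (Bd K)) (hprob : IsProbabilityMeasure ν)
    (hν : ∀ (n : ℕ) (w : Fin n → Fin K), ν (cyl w) = ((K : ℝ≥0∞) ^ n)⁻¹) :
    ∃ C : ℝ, 1 ≤ C ∧ ∀ ξ : Bd K, ∀ r : ℝ, 0 < r → r ≤ 2 / ε →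
      C⁻¹ * r ^ (Real.log K / ε) ≤ (ν {ω : Bd K | treeDist ε ξ ω ≤ r}).toReal ∧
      (ν {ω : Bd K | treeDist ε ξ ω ≤ r}).toReal ≤ C * r ^ (Real.log K / ε) := by
  have hK0 : (0 : ℝ) < K := by exact_mod_cast (by omega : 0 < K)
  have hL : 0 ≤ Real.log K := Real.log_natCast_nonneg K
  have hε2 : 0 < 2 / ε := by positivity
  set A : ℝ := (2 / ε) ^ (Real.log K / ε)
  have hA : 0 < A := Real.rpow_pos_of_pos hε2 _
  refine ⟨max 1 (max A⁻¹ (A * K)), le_max_left _ _, fun ξ r hr hr2 => ?_⟩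
  obtain ⟨t, ht, rfl⟩ : ∃ t : ℝ, 0 ≤ t ∧ r = 2 / ε * Real.exp (-(ε * t)) := by
    refine ⟨-Real.log (r / (2 / ε)) / ε, ?_, ?_⟩
    · have : Real.log (r / (2 / ε)) ≤ 0 :=
        Real.log_nonpos (by positivity) ((div_le_one hε2).mpr hr2)
      exact div_nonneg (by linarith) hε.le
    · rw [mul_div_cancel₀ _ hε.ne', neg_neg, Real.exp_log (by positivity),
        mul_div_cancel₀ _ hε2.ne']
  have hν_ball : (ν (cyl (fun i : Fin ⌈t⌉₊ => ξ i))).toReal =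
      Real.exp (-(⌈t⌉₊ * Real.log K)) := by
    rw [hν, Real.exp_neg, Real.exp_nat_mul, Real.exp_log hK0]
    simp
  have hrQ : (2 / ε * Real.exp (-(ε * t))) ^ (Real.log K / ε) =
      A * Real.exp (-(t * Real.log K)) := by
    rw [Real.mul_rpow hε2.le (Real.exp_pos _).le, ← Real.exp_mul]
    congr 2
    field_simp
  rw [treeDist_closedBall_eq_cyl hε, hν_ball, hrQ]
  constructor
  · have hC : A * K ≤ max 1 (max A⁻¹ (A * K)) := (le_max_right _ _).trans (le_max_right _ _)
    have hexp : Real.exp (-(t * Real.log K)) ≤ K * Real.exp (-(⌈t⌉₊ * Real.log K)) := by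
      conv_rhs => rw [← Real.exp_log hK0, Real.log_exp, ← Real.exp_add]
      rw [Real.exp_le_exp]
      nlinarith [Nat.ceil_lt_add_one ht]
    rw [inv_mul_le_iff₀ (by positivity)]
    calc A * Real.exp (-(t * Real.log K))
        ≤ A * (K * Real.exp (-(⌈t⌉₊ * Real.log K))) := by gcongr
      _ = A * K * Real.exp (-(⌈t⌉₊ * Real.log K)) := by ring
      _ ≤ _ := by gcongr
  · have hC : A⁻¹ ≤ max 1 (max A⁻¹ (A * K)) := (le_max_left _ _).trans (le_max_right _ _)
    calc Real.exp (-(⌈t⌉₊ * Real.log K))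
        ≤ Real.exp (-(t * Real.log K)) := by
          gcongr
          exact Nat.le_ceil t
      _ = A⁻¹ * (A * Real.exp (-(t * Real.log K))) := by
          rw [inv_mul_cancel_left₀ hA.ne']
      _ ≤ _ := by gcongr
end

section
/- Let 0 < θ < 1 and p ≥ 1. There exists a constant C ≥ 1 such that for every f ∈ L¹(ν), C⁻¹·‖f‖_{Ḃ^θ_p} ≤ ‖f‖_{Ḃ^{θ,0}_p} ≤ C·‖f‖_{Ḃ^θ_p}, where ‖f‖_{Ḃ^{θ,0}_p} is the dyadic Besov energy with λ = 0; in particular one side is finite if and only if the other is. -/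
open MeasureTheory ENNReal NNReal

open MeasureTheory ENNReal NNReal

open Classical in
/-- The Besov seminorm `‖f‖_{Ḃ^θ_p}` defined via the double integral
`(∫∫ |f(ζ)-f(ξ)|^p / (d(ζ,ξ)^{θp} ν(B(ζ, d(ζ,ξ)))) dν dν)^{1/p}`, with the integrand
interpreted as `0` on the diagonal. -/
noncomputable def besovSeminorm {K : ℕ} (ν : Measure (Bd K)) (ε θ p : ℝ)
    (f : Bd K → ℝ) : ℝ≥0∞ :=
  (∫⁻ ζ, ∫⁻ ξ,
      (if ζ = ξ then 0
       else ENNReal.ofReal (|f ζ - f ξ| ^ p / treeDist ε ζ ξ ^ (θ * p)) /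
         ν {ω : Bd K | treeDist ε ζ ω ≤ treeDist ε ζ ξ}) ∂ν ∂ν) ^ (1 / p)

theorem rpow_lintegral_le {α : Type*} [MeasurableSpace α] (μ : Measure α) {p : ℝ} (hp : 1 ≤ p)
    {g : α → ℝ≥0∞} (hg : AEMeasurable g μ) :
    (∫⁻ x, g x ∂μ) ^ p ≤ μ Set.univ ^ (p - 1) * ∫⁻ x, g x ^ p ∂μ := by
  have hp0 : 0 < p := by linarith
  rcases hp.eq_or_lt with rfl | hp1
  · simp
  have hc : p.HolderConjugate (p / (p - 1)) := Real.HolderConjugate.conjExponent hp1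
  have h := ENNReal.lintegral_mul_le_Lp_mul_Lq μ hc hg (g := fun _ => 1) aemeasurable_const
  simp only [Pi.mul_apply, mul_one, ENNReal.one_rpow, lintegral_const, one_mul] at h
  calc (∫⁻ x, g x ∂μ) ^ p
      ≤ ((∫⁻ x, g x ^ p ∂μ) ^ (1 / p) * μ Set.univ ^ (1 / (p / (p - 1)))) ^ p := by gcongr
    _ = μ Set.univ ^ (p - 1) * ∫⁻ x, g x ^ p ∂μ := by
        rw [ENNReal.mul_rpow_of_nonneg _ _ hp0.le, ← ENNReal.rpow_mul, ← ENNReal.rpow_mul,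
          one_div_mul_cancel hp0.ne', ENNReal.rpow_one, mul_comm]
        congr 2
        field_simp

theorem rpow_tsum_mul_le {p : ℝ} (hp : 1 ≤ p) (w x : ℕ → ℝ≥0∞) :
    (∑' j, w j * x j) ^ p ≤ (∑' j, w j) ^ (p - 1) * ∑' j, w j * x j ^ p := by
  have h := rpow_lintegral_le (Measure.sum fun j : ℕ => w j • Measure.dirac j) hp
    (g := x) (Measurable.of_discrete).aemeasurable
  simpa [lintegral_sum_measure, lintegral_smul_measure] using h

/-- A weighted Hardy inequality with geometric weights. -/
theorem tsum_geometric_hardy {p : ℝ} (hp : 1 ≤ p) (r : ℝ≥0∞) (hr0 : r ≠ 0) (hrt : r ≠ ∞)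
    (g : ℕ → ℝ≥0∞) :
    ∑' n, (r ^ n * ∑' j, g (n + j)) ^ p ≤ (∑' j, r⁻¹ ^ j) ^ p * ∑' n, (r ^ n * g n) ^ p := by
  have hp0 : 0 ≤ p - 1 := by linarith
  set A := ∑' j, r⁻¹ ^ j
  have h1 (n : ℕ) : r ^ n * ∑' j, g (n + j) = ∑' j, r⁻¹ ^ j * (r ^ (n + j) * g (n + j)) := by
    rw [← ENNReal.tsum_mul_left]
    refine tsum_congr fun j => ?_
    rw [← mul_assoc, pow_add, mul_left_comm, ← mul_pow, ENNReal.inv_mul_cancel hr0 hrt, one_pow,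
      mul_one]
  calc ∑' n, (r ^ n * ∑' j, g (n + j)) ^ p
      ≤ ∑' n, A ^ (p - 1) * ∑' j, r⁻¹ ^ j * (r ^ (n + j) * g (n + j)) ^ p := by
        refine ENNReal.tsum_le_tsum fun n => ?_
        rw [h1]
        exact rpow_tsum_mul_le hp _ _
    _ = A ^ (p - 1) * ∑' j, r⁻¹ ^ j * ∑' n, (r ^ (n + j) * g (n + j)) ^ p := by
        rw [ENNReal.tsum_mul_left, ENNReal.tsum_comm]
        simp_rw [ENNReal.tsum_mul_left]
    _ ≤ A ^ (p - 1) * ∑' j, r⁻¹ ^ j * ∑' n, (r ^ n * g n) ^ p := by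
        refine mul_le_mul' le_rfl (ENNReal.tsum_le_tsum fun j => mul_le_mul' le_rfl ?_)
        exact ENNReal.tsum_comp_le_tsum_of_injective (add_left_injective j)
          fun n => (r ^ n * g n) ^ p
    _ = A ^ p * ∑' n, (r ^ n * g n) ^ p := by
        rw [ENNReal.tsum_mul_right, ← mul_assoc]
        have h := ENNReal.rpow_add_of_nonneg (x := A) _ _ hp0 zero_le_one
        rw [sub_add_cancel, ENNReal.rpow_one] at h
        rw [h]

/-- The word of the first `n` letters. -/
def pre {K : ℕ} (n : ℕ) (ζ : Bd K) : Fin n → Fin K := fun i => ζ i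

theorem measurable_pre {K : ℕ} (n : ℕ) : Measurable (pre n : Bd K → Fin n → Fin K) :=
  measurable_pi_lambda _ fun i => measurable_pi_apply (i : ℕ)

theorem cyl_eq_preimage {K n : ℕ} (w : Fin n → Fin K) : cyl w = pre n ⁻¹' {w} := by
  ext ξ
  simp [cyl, pre, funext_iff]

theorem mem_cyl_iff {K n : ℕ} {w : Fin n → Fin K} {ξ : Bd K} : ξ ∈ cyl w ↔ pre n ξ = w := by
  rw [cyl_eq_preimage]; rfl

theorem measurableSet_cyl {K n : ℕ} (w : Fin n → Fin K) : MeasurableSet (cyl w) := by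
  rw [cyl_eq_preimage]
  exact measurable_pre n (measurableSet_singleton w)

theorem lintegral_comp_pre {K n : ℕ} (ν : Measure (Bd K)) (G : (Fin n → Fin K) → ℝ≥0∞) :
    ∫⁻ ζ, G (pre n ζ) ∂ν = ∑ w, ν (cyl w) * G w := by
  rw [← lintegral_map (Measurable.of_discrete (f := G)) (measurable_pre n), lintegral_fintype]
  refine Finset.sum_congr rfl fun w _ => ?_
  rw [Measure.map_apply (measurable_pre n) (measurableSet_singleton w), ← cyl_eq_preimage,
    mul_comm]

theorem pairwise_disjoint_cyl {K n : ℕ} :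
    Pairwise (Function.onFun Disjoint fun w : Fin n → Fin K => cyl w) := by
  intro v w h
  refine Set.disjoint_left.2 fun ξ hv hw => h ?_
  rw [mem_cyl_iff] at hv hw
  rw [← hv, hw]

theorem sum_setLIntegral_cyl {K n : ℕ} (ν : Measure (Bd K)) (g : Bd K → ℝ≥0∞) :
    ∑ w : Fin n → Fin K, ∫⁻ ζ in cyl w, g ζ ∂ν = ∫⁻ ζ, g ζ ∂ν := by
  have hU : ⋃ w : Fin n → Fin K, cyl w = Set.univ :=
    Set.eq_univ_of_forall fun ζ => Set.mem_iUnion.2 ⟨pre n ζ, mem_cyl_iff.2 rfl⟩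
  rw [← setLIntegral_univ (μ := ν) g, ← hU, lintegral_iUnion measurableSet_cyl pairwise_disjoint_cyl,
    tsum_fintype]

/-- The filtration generated by the first `n` letters. -/
def preFiltration (K : ℕ) : Filtration ℕ (inferInstance : MeasurableSpace (Bd K)) where
  seq n := MeasurableSpace.comap (pre n) inferInstance
  mono' m n h := by
    have : (pre m : Bd K → _) = (fun v : Fin n → Fin K => fun i => v (Fin.castLE h i)) ∘ pre n := rfl
    change MeasurableSpace.comap (pre m) _ ≤ MeasurableSpace.comap (pre n) _
    rw [this, ← MeasurableSpace.comap_comp]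
    exact MeasurableSpace.comap_mono (Measurable.of_discrete).comap_le
  le' n := (measurable_pre n).comap_le

theorem iSup_preFiltration (K : ℕ) :
    ⨆ n, preFiltration K n = (inferInstance : MeasurableSpace (Bd K)) := by
  refine le_antisymm (iSup_le (preFiltration K).le) ?_
  refine iSup_le fun i => ?_
  refine le_trans ?_ (le_iSup _ (i + 1))
  have : (fun ζ : Bd K => ζ i) = (fun v : Fin (i + 1) → Fin K => v (Fin.last i)) ∘ pre (i + 1) := rfl
  change MeasurableSpace.comap (fun ζ : Bd K => ζ i) _ ≤ MeasurableSpace.comap (pre (i + 1)) _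
  rw [this, ← MeasurableSpace.comap_comp]
  exact MeasurableSpace.comap_mono (Measurable.of_discrete).comap_le

theorem measure_mul_cylAvg {K n : ℕ} (ν : Measure (Bd K)) [IsFiniteMeasure ν] (f : Bd K → ℝ)
    (w : Fin n → Fin K) : ν.real (cyl w) * cylAvg ν f w = ∫ ζ in cyl w, f ζ ∂ν := by
  by_cases h : ν (cyl w) = 0
  · simp [Measure.real, h, Measure.restrict_eq_zero.2 h]
  · rw [cylAvg, ← mul_assoc, Measure.real, mul_inv_cancel₀, one_mul]
    exact (ENNReal.toReal_pos h (measure_ne_top _ _)).ne'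

theorem integrable_cylAvg_pre {K : ℕ} (ν : Measure (Bd K)) [IsFiniteMeasure ν] (f : Bd K → ℝ)
    (n : ℕ) : Integrable (fun ζ => cylAvg ν f (pre n ζ)) ν :=
  (Integrable.of_finite (μ := ν.map (pre n)) (f := fun w => cylAvg ν f w)).comp_measurable
    (measurable_pre n)

theorem cylAvg_ae_eq_condExp {K : ℕ} (ν : Measure (Bd K)) [IsFiniteMeasure ν] {f : Bd K → ℝ}
    (hf : Integrable f ν) (n : ℕ) :
    (fun ζ => cylAvg ν f (pre n ζ)) =ᵐ[ν] ν[f | preFiltration K n] := by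
  have hi := integrable_cylAvg_pre ν f n
  refine ae_eq_condExp_of_forall_setIntegral_eq ((preFiltration K).le n) hf
    (fun s _ _ => hi.integrableOn) ?_ ?_
  · rintro _ ⟨T, -, rfl⟩ -
    have hT : pre n ⁻¹' T = ⋃ w ∈ T.toFinite.toFinset, cyl w := by
      ext ζ
      simp [mem_cyl_iff]
    rw [hT, integral_biUnion_finset _ (fun w _ => measurableSet_cyl w)
      (fun v _ w _ h => pairwise_disjoint_cyl h) (fun w _ => hi.integrableOn),
      integral_biUnion_finset _ (fun w _ => measurableSet_cyl w)
      (fun v _ w _ h => pairwise_disjoint_cyl h) (fun w _ => hf.integrableOn)]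
    refine Finset.sum_congr rfl fun w _ => ?_
    rw [← measure_mul_cylAvg ν f w, setIntegral_congr_fun (measurableSet_cyl w)
      (g := fun _ => cylAvg ν f w) (fun ζ hζ => by simp only [mem_cyl_iff.1 hζ])]
    simp
  · have h : StronglyMeasurable[preFiltration K n] fun ζ => cylAvg ν f (pre n ζ) := by
      refine Measurable.stronglyMeasurable ?_
      exact (Measurable.of_discrete (f := fun w : Fin n → Fin K => cylAvg ν f w)).comp
        (comap_measurable (pre n))
    exact h.aestronglyMeasurable

theorem ae_tendsto_cylAvg {K : ℕ} (ν : Measure (Bd K)) [IsFiniteMeasure ν] {f : Bd K → ℝ}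
    (hf : Integrable f ν) (hfm : Measurable f) :
    ∀ᵐ ζ ∂ν, Filter.Tendsto (fun n => cylAvg ν f (pre n ζ)) Filter.atTop (nhds (f ζ)) := by
  have h := hf.tendsto_ae_condExp (ℱ := preFiltration K)
    (by rw [iSup_preFiltration]; exact hfm.stronglyMeasurable)
  filter_upwards [h, ae_all_iff.2 (cylAvg_ae_eq_condExp ν hf)] with ζ h1 h2
  simpa only [h2] using h1

/-- The words that agree with `ζ` in exactly the first `n` letters. -/
def shell {K : ℕ} (n : ℕ) (ζ : Bd K) : Set (Bd K) := {ξ | pre n ζ = pre n ξ ∧ ζ n ≠ ξ n}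

theorem pre_succ_eq_iff {K n : ℕ} {ζ ξ : Bd K} :
    pre (n + 1) ζ = pre (n + 1) ξ ↔ pre n ζ = pre n ξ ∧ ζ n = ξ n := by
  simp only [funext_iff, pre]
  exact Fin.forall_fin_succ'

theorem shell_eq_diff {K n : ℕ} (ζ : Bd K) :
    shell n ζ = cyl (pre n ζ) \ cyl (pre (n + 1) ζ) := by
  ext ξ
  simp only [shell, Set.mem_ofPred_eq, Set.mem_sdiff, mem_cyl_iff, eq_comm (a := pre _ ξ),
    pre_succ_eq_iff]
  tauto

theorem measurableSet_shell {K n : ℕ} (ζ : Bd K) : MeasurableSet (shell n ζ) := by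
  rw [shell_eq_diff]
  exact (measurableSet_cyl _).diff (measurableSet_cyl _)

theorem sInf_ne_of_mem_shell {K n : ℕ} {ζ ξ : Bd K} (h : ξ ∈ shell n ζ) :
    sInf {m : ℕ | ζ m ≠ ξ m} = n := by
  refine IsLeast.csInf_eq ⟨h.2, fun m hm => ?_⟩
  by_contra! hlt
  exact hm (congrFun h.1 ⟨m, hlt⟩)

theorem mem_shell_sInf {K : ℕ} {ζ ξ : Bd K} (h : ζ ≠ ξ) :
    ξ ∈ shell (sInf {m : ℕ | ζ m ≠ ξ m}) ζ := by
  refine ⟨funext fun i => ?_, Nat.sInf_mem (Function.ne_iff.1 h)⟩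
  by_contra hi
  exact Nat.notMem_of_lt_sInf i.2 hi

theorem ne_of_mem_shell {K n : ℕ} {ζ ξ : Bd K} (h : ξ ∈ shell n ζ) : ζ ≠ ξ :=
  fun e => h.2 (by rw [e])

theorem treeDist_of_mem_shell {K n : ℕ} {ε : ℝ} {ζ ξ : Bd K} (h : ξ ∈ shell n ζ) :
    treeDist ε ζ ξ = 2 / ε * Real.exp (-(ε * n)) := by
  rw [treeDist, if_neg (ne_of_mem_shell h), sInf_ne_of_mem_shell h]

theorem setOf_treeDist_le {K : ℕ} {ε : ℝ} (hε : 0 < ε) (n : ℕ) (ζ : Bd K) :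
    {ω : Bd K | treeDist ε ζ ω ≤ 2 / ε * Real.exp (-(ε * n))} = cyl (pre n ζ) := by
  ext ω
  rw [Set.mem_ofPred_eq, mem_cyl_iff]
  by_cases h : ζ = ω
  · subst h
    simp only [treeDist, if_true, iff_true]
    positivity
  · have hm := mem_shell_sInf h
    rw [treeDist, if_neg h, mul_le_mul_iff_right₀ (by positivity), Real.exp_le_exp, neg_le_neg_iff,
      mul_le_mul_iff_right₀ hε, Nat.cast_le]
    refine ⟨fun hle => funext fun i => (congrFun hm.1 ⟨i, i.2.trans_le hle⟩).symm, fun he => ?_⟩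
    by_contra! hlt
    exact hm.2 (congrFun he ⟨_, hlt⟩).symm

theorem enorm_rpow_eq {p : ℝ} (hp : 0 ≤ p) (x : ℝ) : ENNReal.ofReal (|x| ^ p) = ‖x‖ₑ ^ p := by
  rw [← ENNReal.ofReal_rpow_of_nonneg (abs_nonneg x) hp, Real.enorm_eq_ofReal_abs]

/-- The contribution to the Besov double integral of the pairs that agree in exactly the first `n`
letters. -/
noncomputable def shellEnergy {K : ℕ} (ν : Measure (Bd K)) (p : ℝ) (f : Bd K → ℝ) (n : ℕ) : ℝ≥0∞ :=
  ∫⁻ ζ, ∫⁻ ξ in shell n ζ, ‖f ζ - f ξ‖ₑ ^ p ∂ν ∂ν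

theorem measurable_indicator_shell {K : ℕ} {p : ℝ} {f : Bd K → ℝ} (hf : Measurable f) (n : ℕ) :
    Measurable fun q : Bd K × Bd K =>
      (shell n q.1).indicator (fun ξ => ‖f q.1 - f ξ‖ₑ ^ p) q.2 := by
  have hS : MeasurableSet {q : Bd K × Bd K | q.2 ∈ shell n q.1} := by
    have h1 : MeasurableSet {q : Bd K × Bd K | pre n q.1 = pre n q.2} :=
      measurableSet_eq_fun ((measurable_pre n).comp measurable_fst)
        ((measurable_pre n).comp measurable_snd)
    have h2 : MeasurableSet {q : Bd K × Bd K | q.1 n = q.2 n} :=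
      measurableSet_eq_fun (by fun_prop) (by fun_prop)
    exact h1.inter h2.compl
  have hg : Measurable fun q : Bd K × Bd K => ‖f q.1 - f q.2‖ₑ ^ p := by fun_prop
  exact hg.indicator hS

open Classical in
theorem besovSeminorm_eq {K : ℕ} {ε : ℝ} (hε : 0 < ε) (ν : Measure (Bd K)) [IsFiniteMeasure ν]
    (hν : ∀ (n : ℕ) (w : Fin n → Fin K), ν (cyl w) = ((K : ℝ≥0∞) ^ n)⁻¹)
    {p θ : ℝ} (hp : 0 ≤ p) {f : Bd K → ℝ} (hf : Measurable f) :
    besovSeminorm ν ε θ p f = (ENNReal.ofReal ((2 / ε) ^ (-(θ * p))) *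
      ∑' n : ℕ, ENNReal.ofReal (Real.exp (ε * n * θ * p)) * (K : ℝ≥0∞) ^ n *
        shellEnergy ν p f n) ^ (1 / p) := by
  have hint (ζ ξ : Bd K) :
      (if ζ = ξ then 0
       else ENNReal.ofReal (|f ζ - f ξ| ^ p / treeDist ε ζ ξ ^ (θ * p)) /
         ν {ω : Bd K | treeDist ε ζ ω ≤ treeDist ε ζ ξ}) =
      ∑' n : ℕ, ENNReal.ofReal ((2 / ε) ^ (-(θ * p))) *
        (ENNReal.ofReal (Real.exp (ε * n * θ * p)) * (K : ℝ≥0∞) ^ n) *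
        (shell n ζ).indicator (fun ξ => ‖f ζ - f ξ‖ₑ ^ p) ξ := by
    split_ifs with h
    · refine (ENNReal.tsum_eq_zero.2 fun n => ?_).symm
      rw [Set.indicator_of_notMem fun hξ => ne_of_mem_shell hξ h, mul_zero]
    · have hm := mem_shell_sInf h
      set m := sInf {m : ℕ | ζ m ≠ ξ m}
      rw [tsum_eq_single m, Set.indicator_of_mem hm, treeDist_of_mem_shell hm,
        setOf_treeDist_le hε, hν, div_eq_mul_inv, inv_inv, ← enorm_rpow_eq hp]
      · have hD : |f ζ - f ξ| ^ p / (2 / ε * Real.exp (-(ε * m))) ^ (θ * p) =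
            (2 / ε) ^ (-(θ * p)) * Real.exp (ε * m * θ * p) * |f ζ - f ξ| ^ p := by
          rw [Real.mul_rpow (by positivity) (Real.exp_pos _).le, ← Real.exp_mul, div_eq_mul_inv,
            mul_inv, ← Real.exp_neg, Real.rpow_neg (by positivity),
            show -(-(ε * m) * (θ * p)) = ε * m * θ * p by ring]
          ring
        rw [hD, ENNReal.ofReal_mul (by positivity), ENNReal.ofReal_mul (by positivity)]
        ring
      · intro n hn
        rw [Set.indicator_of_notMem, mul_zero]
        exact fun hξ => hn (sInf_ne_of_mem_shell hξ).symm
  rw [besovSeminorm]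
  congr 1
  simp_rw [hint]
  have hmi (n : ℕ) : Measurable fun q : Bd K × Bd K =>
      ENNReal.ofReal ((2 / ε) ^ (-(θ * p))) *
        (ENNReal.ofReal (Real.exp (ε * n * θ * p)) * (K : ℝ≥0∞) ^ n) *
        (shell n q.1).indicator (fun ξ => ‖f q.1 - f ξ‖ₑ ^ p) q.2 :=
    (measurable_indicator_shell hf n).const_mul _
  have hm1 (ζ : Bd K) (n : ℕ) :
      Measurable fun ξ => (shell n ζ).indicator (fun ξ => ‖f ζ - f ξ‖ₑ ^ p) ξ :=
    (measurable_indicator_shell hf n).comp measurable_prodMk_left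
  have hm2 (n : ℕ) :
      Measurable fun ζ => ∫⁻ ξ, (shell n ζ).indicator (fun ξ => ‖f ζ - f ξ‖ₑ ^ p) ξ ∂ν :=
    (measurable_indicator_shell hf n).lintegral_prod_right'
  simp_rw [lintegral_tsum fun n => ((hm1 _ n).const_mul _).aemeasurable,
    lintegral_const_mul _ (hm1 _ _)]
  simp_rw [lintegral_tsum fun n => ((hm2 n).const_mul _).aemeasurable,
    lintegral_const_mul _ (hm2 _), lintegral_indicator (measurableSet_shell _), mul_assoc,
    ENNReal.tsum_mul_left]
  rfl

theorem besovEnergy_zero_eq {K : ℕ} (ν : Measure (Bd K)) [IsFiniteMeasure ν] {ε θ p : ℝ}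
    (hp : 0 ≤ p) (f : Bd K → ℝ) :
    besovEnergy ν ε θ p 0 f = ∑' n : ℕ, ENNReal.ofReal (Real.exp (ε * ((n : ℝ) + 1) * θ * p)) *
      ∑ w : Fin (n + 1) → Fin K,
        ν (cyl w) * ‖cylAvg ν f w - cylAvg ν f (Fin.init w)‖ₑ ^ p := by
  refine tsum_congr fun n => ?_
  rw [Real.rpow_zero, mul_one, ENNReal.ofReal_mul (by positivity),
    ENNReal.ofReal_sum_of_nonneg fun w _ => by positivity]
  congr 1
  refine Finset.sum_congr rfl fun w _ => ?_
  rw [ENNReal.ofReal_mul ENNReal.toReal_nonneg, ENNReal.ofReal_toReal (measure_ne_top _ _),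
    enorm_rpow_eq hp]

theorem besovSeminorm_congr {K : ℕ} {ν : Measure (Bd K)} {ε θ p : ℝ} {f g : Bd K → ℝ}
    (h : f =ᵐ[ν] g) : besovSeminorm ν ε θ p f = besovSeminorm ν ε θ p g := by
  rw [besovSeminorm, besovSeminorm]
  congr 1
  refine lintegral_congr_ae ?_
  filter_upwards [h] with ζ hζ
  refine lintegral_congr_ae ?_
  filter_upwards [h] with ξ hξ
  rw [hζ, hξ]

theorem besovEnergy_congr {K : ℕ} {ν : Measure (Bd K)} {ε θ p lam : ℝ} {f g : Bd K → ℝ}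
    (h : f =ᵐ[ν] g) : besovEnergy ν ε θ p lam f = besovEnergy ν ε θ p lam g := by
  have hA {n : ℕ} (w : Fin n → Fin K) : cylAvg ν f w = cylAvg ν g w := by
    rw [cylAvg, cylAvg, integral_congr_ae (ae_restrict_of_ae h)]
  simp_rw [besovEnergy, hA]

theorem cyl_subset_cyl_init {K n : ℕ} (w : Fin (n + 1) → Fin K) : cyl w ⊆ cyl (Fin.init w) :=
  fun _ h i => h i.castSucc

theorem cylAvg_sub_cylAvg_init {K n : ℕ} (ν : Measure (Bd K)) [IsFiniteMeasure ν] {f : Bd K → ℝ}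
    (hf : Integrable f ν) (w : Fin (n + 1) → Fin K) (hw : ν (cyl w) ≠ 0) :
    cylAvg ν f w - cylAvg ν f (Fin.init w) =
      (ν.real (cyl w) * ν.real (cyl (Fin.init w)))⁻¹ *
        ∫ η in cyl w, ∫ ξ in cyl (Fin.init w) \ cyl w, (f η - f ξ) ∂ν ∂ν := by
  have hsub := cyl_subset_cyl_init w
  have ha : 0 < ν.real (cyl w) := ENNReal.toReal_pos hw (measure_ne_top _ _)
  have hb : 0 < ν.real (cyl (Fin.init w)) := ha.trans_le (measureReal_mono hsub)
  have hin (η : Bd K) : ∫ ξ in cyl (Fin.init w) \ cyl w, (f η - f ξ) ∂ν =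
      ν.real (cyl (Fin.init w) \ cyl w) * f η - ∫ ξ in cyl (Fin.init w) \ cyl w, f ξ ∂ν := by
    rw [integral_sub (integrable_const _) hf.integrableOn]
    simp
  simp_rw [hin]
  rw [integral_sub (hf.integrableOn.const_mul _) (integrable_const _), integral_const_mul,
    setIntegral_const, measureReal_sdiff hsub (measurableSet_cyl w),
    setIntegral_sdiff (measurableSet_cyl w) hf.integrableOn hsub, cylAvg, cylAvg, ← Measure.real,
    ← Measure.real, smul_eq_mul]
  field_simp
  ring

theorem measure_mul_enorm_cylAvg_sub_rpow_le {K n : ℕ} (ν : Measure (Bd K)) [IsFiniteMeasure ν]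
    {p : ℝ} (hp : 1 ≤ p) {f : Bd K → ℝ} (hf : Integrable f ν) (hfm : Measurable f)
    (w : Fin (n + 1) → Fin K) :
    ν (cyl w) * ‖cylAvg ν f w - cylAvg ν f (Fin.init w)‖ₑ ^ p ≤ (ν (cyl (Fin.init w)))⁻¹ *
      ∫⁻ η in cyl w, ∫⁻ ξ in cyl (Fin.init w) \ cyl w, ‖f η - f ξ‖ₑ ^ p ∂ν ∂ν := by
  have hsub := cyl_subset_cyl_init w
  by_cases hw : ν (cyl w) = 0
  · simp [hw]
  have hwi : ν (cyl (Fin.init w)) ≠ 0 := fun h => hw (measure_mono_null hsub h)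
  have hp0 : 0 ≤ p - 1 := by linarith
  set κ := (ν (cyl w) * ν (cyl (Fin.init w)))⁻¹ with hκ
  set μ := κ • (ν.restrict (cyl w)).prod (ν.restrict (cyl (Fin.init w) \ cyl w))
  have hμ (q : ℝ) : ∫⁻ x, ‖f x.1 - f x.2‖ₑ ^ q ∂μ =
      κ * ∫⁻ η in cyl w, ∫⁻ ξ in cyl (Fin.init w) \ cyl w, ‖f η - f ξ‖ₑ ^ q ∂ν ∂ν := by
    rw [lintegral_smul_measure, lintegral_prod _ (by fun_prop), smul_eq_mul]
  have hμ1 : μ Set.univ ≤ 1 := by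
    rw [Measure.smul_apply, ← Set.univ_prod_univ, Measure.prod_prod, Measure.restrict_apply_univ,
      Measure.restrict_apply_univ, smul_eq_mul]
    calc κ * (ν (cyl w) * ν (cyl (Fin.init w) \ cyl w))
        ≤ κ * (ν (cyl w) * ν (cyl (Fin.init w))) := by gcongr; exact Set.sdiff_subset
      _ ≤ 1 := ENNReal.inv_mul_le_one _
  have hle : ‖cylAvg ν f w - cylAvg ν f (Fin.init w)‖ₑ ≤ ∫⁻ x, ‖f x.1 - f x.2‖ₑ ∂μ := by
    have h1 := hμ 1
    simp only [ENNReal.rpow_one] at h1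
    rw [cylAvg_sub_cylAvg_init ν hf w hw, enorm_mul, h1]
    gcongr
    · rw [Real.enorm_eq_ofReal (by positivity), Measure.real, Measure.real, ← ENNReal.toReal_mul,
        ← ENNReal.toReal_inv, ENNReal.ofReal_toReal]
      exact ENNReal.inv_ne_top.2 (mul_ne_zero hw hwi)
    · exact (enorm_integral_le_lintegral_enorm _).trans
        (lintegral_mono fun η => enorm_integral_le_lintegral_enorm _)
  calc ν (cyl w) * ‖cylAvg ν f w - cylAvg ν f (Fin.init w)‖ₑ ^ p
      ≤ ν (cyl w) * (∫⁻ x, ‖f x.1 - f x.2‖ₑ ∂μ) ^ p := by gcongr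
    _ ≤ ν (cyl w) * (μ Set.univ ^ (p - 1) * ∫⁻ x, ‖f x.1 - f x.2‖ₑ ^ p ∂μ) := by
        gcongr
        exact rpow_lintegral_le μ hp (by fun_prop)
    _ ≤ ν (cyl w) * (1 * ∫⁻ x, ‖f x.1 - f x.2‖ₑ ^ p ∂μ) := by
        gcongr
        exact ENNReal.rpow_le_one hμ1 hp0
    _ = _ := by
        rw [one_mul, hμ, ← mul_assoc, hκ, ENNReal.mul_inv (.inl hw) (.inl (measure_ne_top _ _)),
          ← mul_assoc, ENNReal.mul_inv_cancel hw (measure_ne_top _ _), one_mul]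

theorem sum_enorm_cylAvg_sub_rpow_le {K : ℕ} (ν : Measure (Bd K)) [IsFiniteMeasure ν]
    (hν : ∀ (n : ℕ) (w : Fin n → Fin K), ν (cyl w) = ((K : ℝ≥0∞) ^ n)⁻¹)
    {p : ℝ} (hp : 1 ≤ p) {f : Bd K → ℝ} (hf : Integrable f ν) (hfm : Measurable f) (n : ℕ) :
    ∑ w : Fin (n + 1) → Fin K, ν (cyl w) * ‖cylAvg ν f w - cylAvg ν f (Fin.init w)‖ₑ ^ p ≤
      (K : ℝ≥0∞) ^ n * shellEnergy ν p f n := by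
  rw [shellEnergy, ← sum_setLIntegral_cyl (n := n + 1), Finset.mul_sum]
  refine Finset.sum_le_sum fun w _ =>
    (measure_mul_enorm_cylAvg_sub_rpow_le ν hp hf hfm w).trans_eq ?_
  rw [hν, inv_inv]
  congr 1
  refine setLIntegral_congr_fun (measurableSet_cyl w) fun η hη => ?_
  rw [mem_cyl_iff] at hη
  subst hη
  simp only [shell_eq_diff]
  rfl

theorem enorm_sub_cylAvg_le {K : ℕ} (ν : Measure (Bd K)) (f : Bd K → ℝ) {ζ : Bd K}
    (h : Filter.Tendsto (fun n => cylAvg ν f (pre n ζ)) Filter.atTop (nhds (f ζ))) (n : ℕ) :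
    ‖f ζ - cylAvg ν f (pre n ζ)‖ₑ ≤
      ∑' j, ‖cylAvg ν f (pre (n + j + 1) ζ) - cylAvg ν f (pre (n + j) ζ)‖ₑ := by
  have := edist_le_tsum_of_edist_le_of_tendsto
    (fun n => ‖cylAvg ν f (pre (n + 1) ζ) - cylAvg ν f (pre n ζ)‖ₑ)
    (fun n => by rw [edist_comm, edist_eq_enorm_sub]) h n
  rwa [edist_comm, edist_eq_enorm_sub] at this

theorem shellEnergy_le {K : ℕ} (ν : Measure (Bd K)) [IsFiniteMeasure ν]
    (hν : ∀ (n : ℕ) (w : Fin n → Fin K), ν (cyl w) = ((K : ℝ≥0∞) ^ n)⁻¹)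
    {p : ℝ} (hp : 1 ≤ p) {f : Bd K → ℝ} (hfm : Measurable f) (n : ℕ) :
    shellEnergy ν p f n ≤
      ((K : ℝ≥0∞) ^ n)⁻¹ * (2 ^ p * ∫⁻ ζ, ‖f ζ - cylAvg ν f (pre n ζ)‖ₑ ^ p ∂ν) := by
  set u : Bd K → ℝ≥0∞ := fun ζ => ‖f ζ - cylAvg ν f (pre n ζ)‖ₑ ^ p
  have hum : Measurable u := by
    have : Measurable fun ζ => cylAvg ν f (pre n ζ) :=
      (Measurable.of_discrete (f := fun w : Fin n → Fin K => cylAvg ν f w)).comp (measurable_pre n)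
    fun_prop
  have hpt (ζ ξ : Bd K) (h : ξ ∈ cyl (pre n ζ)) :
      ‖f ζ - f ξ‖ₑ ^ p ≤ 2 ^ (p - 1) * (u ζ + u ξ) := by
    rw [mem_cyl_iff] at h
    refine le_trans ?_ (ENNReal.rpow_add_le_mul_rpow_add_rpow _ _ hp)
    gcongr
    calc ‖f ζ - f ξ‖ₑ
        = ‖(f ζ - cylAvg ν f (pre n ζ)) - (f ξ - cylAvg ν f (pre n ξ))‖ₑ := by
          rw [h]; congr 1; ring
      _ ≤ _ := enorm_sub_le
  have hsecond : ∫⁻ ζ, ∫⁻ ξ in cyl (pre n ζ), u ξ ∂ν ∂ν = ((K : ℝ≥0∞) ^ n)⁻¹ * ∫⁻ ζ, u ζ ∂ν := by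
    rw [lintegral_comp_pre ν fun w : Fin n → Fin K => ∫⁻ ξ in cyl w, u ξ ∂ν]
    simp_rw [hν]
    rw [← Finset.mul_sum, sum_setLIntegral_cyl]
  have hmeas : Measurable fun ζ => ∫⁻ ξ in cyl (pre n ζ), u ξ ∂ν :=
    (Measurable.of_discrete (f := fun w : Fin n → Fin K => ∫⁻ ξ in cyl w, u ξ ∂ν)).comp
      (measurable_pre n)
  calc shellEnergy ν p f n
      ≤ ∫⁻ ζ, ∫⁻ ξ in cyl (pre n ζ), 2 ^ (p - 1) * (u ζ + u ξ) ∂ν ∂ν := by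
        refine lintegral_mono fun ζ => ?_
        refine (lintegral_mono_set (shell_eq_diff (n := n) ζ ▸ Set.sdiff_subset)).trans ?_
        exact setLIntegral_mono' (measurableSet_cyl _) (hpt ζ)
    _ = 2 ^ (p - 1) * ∫⁻ ζ, (((K : ℝ≥0∞) ^ n)⁻¹ * u ζ + ∫⁻ ξ in cyl (pre n ζ), u ξ ∂ν) ∂ν := by
        rw [← lintegral_const_mul (2 ^ (p - 1)) (by fun_prop)]
        refine lintegral_congr fun ζ => ?_
        rw [lintegral_const_mul _ (by fun_prop), lintegral_add_left measurable_const,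
          setLIntegral_const, hν, mul_comm (u ζ)]
    _ = 2 ^ (p - 1) * 2 ^ (1 : ℝ) * (((K : ℝ≥0∞) ^ n)⁻¹ * ∫⁻ ζ, u ζ ∂ν) := by
        rw [lintegral_add_left (hum.const_mul _), lintegral_const_mul _ hum, hsecond,
          ENNReal.rpow_one]
        ring
    _ = _ := by
        rw [← ENNReal.rpow_add _ _ two_ne_zero ofNat_ne_top, sub_add_cancel]
        ring

theorem tsum_shellEnergy_le {K : ℕ} (hK : K ≠ 0) (ν : Measure (Bd K)) [IsFiniteMeasure ν]
    (hν : ∀ (n : ℕ) (w : Fin n → Fin K), ν (cyl w) = ((K : ℝ≥0∞) ^ n)⁻¹)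
    {p : ℝ} (hp : 1 ≤ p) {f : Bd K → ℝ} (hf : Integrable f ν) (hfm : Measurable f)
    (r : ℝ≥0∞) (hr0 : r ≠ 0) (hrt : r ≠ ∞) :
    ∑' n, (r ^ n) ^ p * (K : ℝ≥0∞) ^ n * shellEnergy ν p f n ≤
      2 ^ p * (∑' j, r⁻¹ ^ j) ^ p * ∑' n, (r ^ n) ^ p * ∑ w : Fin (n + 1) → Fin K,
        ν (cyl w) * ‖cylAvg ν f w - cylAvg ν f (Fin.init w)‖ₑ ^ p := by
  have hp0 : 0 ≤ p := by linarith
  set g : ℕ → Bd K → ℝ≥0∞ := fun n ζ => ‖cylAvg ν f (pre (n + 1) ζ) - cylAvg ν f (pre n ζ)‖ₑ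
  have hcm (n : ℕ) : Measurable fun ζ => cylAvg ν f (pre n ζ) :=
    (Measurable.of_discrete (f := fun w : Fin n → Fin K => cylAvg ν f w)).comp (measurable_pre n)
  have hgm (n : ℕ) : Measurable (g n) := by
    have h1 := hcm n
    have h2 := hcm (n + 1)
    fun_prop
  have hgs (n : ℕ) : ∫⁻ ζ, g n ζ ^ p ∂ν = ∑ w : Fin (n + 1) → Fin K,
      ν (cyl w) * ‖cylAvg ν f w - cylAvg ν f (Fin.init w)‖ₑ ^ p :=
    lintegral_comp_pre ν fun w : Fin (n + 1) → Fin K =>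
      ‖cylAvg ν f w - cylAvg ν f (Fin.init w)‖ₑ ^ p
  have hKn (n : ℕ) : (K : ℝ≥0∞) ^ n ≠ 0 := pow_ne_zero _ (Nat.cast_ne_zero.2 hK)
  have hKt (n : ℕ) : (K : ℝ≥0∞) ^ n ≠ ∞ := ENNReal.pow_ne_top (ENNReal.natCast_ne_top K)
  calc ∑' n, (r ^ n) ^ p * (K : ℝ≥0∞) ^ n * shellEnergy ν p f n
      ≤ ∑' n, 2 ^ p * ∫⁻ ζ, (r ^ n * ∑' j, g (n + j) ζ) ^ p ∂ν := by
        refine ENNReal.tsum_le_tsum fun n => ?_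
        calc (r ^ n) ^ p * (K : ℝ≥0∞) ^ n * shellEnergy ν p f n
            ≤ (r ^ n) ^ p * (K : ℝ≥0∞) ^ n * (((K : ℝ≥0∞) ^ n)⁻¹ *
                (2 ^ p * ∫⁻ ζ, ‖f ζ - cylAvg ν f (pre n ζ)‖ₑ ^ p ∂ν)) := by
              gcongr
              exact shellEnergy_le ν hν hp hfm n
          _ = 2 ^ p * ((r ^ n) ^ p * ∫⁻ ζ, ‖f ζ - cylAvg ν f (pre n ζ)‖ₑ ^ p ∂ν) := by
              rw [← mul_assoc, mul_assoc _ _ (((K : ℝ≥0∞) ^ n)⁻¹),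
                ENNReal.mul_inv_cancel (hKn n) (hKt n)]
              ring
          _ ≤ 2 ^ p * ((r ^ n) ^ p * ∫⁻ ζ, (∑' j, g (n + j) ζ) ^ p ∂ν) := by
              refine mul_le_mul' le_rfl (mul_le_mul' le_rfl (lintegral_mono_ae ?_))
              filter_upwards [ae_tendsto_cylAvg ν hf hfm] with ζ hζ
              exact ENNReal.rpow_le_rpow (enorm_sub_cylAvg_le ν f hζ n) hp0
          _ = _ := by
              simp_rw [ENNReal.mul_rpow_of_nonneg _ _ hp0]
              rw [lintegral_const_mul]
              exact (Measurable.tsum fun j => hgm (n + j)).pow_const p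
    _ = 2 ^ p * ∫⁻ ζ, ∑' n, (r ^ n * ∑' j, g (n + j) ζ) ^ p ∂ν := by
        rw [ENNReal.tsum_mul_left, lintegral_tsum]
        intro n
        exact (((Measurable.tsum fun j => hgm (n + j)).const_mul _).pow_const p).aemeasurable
    _ ≤ 2 ^ p * ∫⁻ ζ, (∑' j, r⁻¹ ^ j) ^ p * ∑' n, (r ^ n * g n ζ) ^ p ∂ν := by
        gcongr with ζ
        exact tsum_geometric_hardy hp r hr0 hrt fun n => g n ζ
    _ = _ := by
        rw [lintegral_const_mul _ (Measurable.tsum fun n =>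
          ((hgm n).const_mul _).pow_const p), lintegral_tsum fun n =>
          (((hgm n).const_mul _).pow_const p).aemeasurable, ← mul_assoc]
        simp_rw [ENNReal.mul_rpow_of_nonneg _ _ hp0,
          lintegral_const_mul _ ((hgm _).pow_const p), hgs]

theorem rpow_one_div_le_mul {a b c : ℝ≥0∞} {p : ℝ} (hp : 0 < p) (h : a ≤ c * b) :
    a ^ (1 / p) ≤ c ^ (1 / p) * b ^ (1 / p) := by
  rw [← ENNReal.mul_rpow_of_nonneg _ _ (by positivity)]
  gcongr

/-- For `0 < θ < 1` and `p ≥ 1`, the Besov seminorm `‖f‖_{Ḃ^θ_p}` and the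
dyadic Besov seminorm `‖f‖_{Ḃ^{θ,0}_p}` (with `λ = 0`) are comparable for all `f ∈ L¹(ν)`;
in particular one is finite iff the other is. -/
theorem statement6 (K : ℕ) (hK : 2 ≤ K) (ε : ℝ) (hε : 0 < ε)
    (ν : Measure (Bd K)) (hprob : IsProbabilityMeasure ν)
    (hν : ∀ (n : ℕ) (w : Fin n → Fin K), ν (cyl w) = ((K : ℝ≥0∞) ^ n)⁻¹)
    (p θ : ℝ) (hp : 1 ≤ p) (hθ0 : 0 < θ) (hθ1 : θ < 1) :
    ∃ C : ℝ≥0, 1 ≤ C ∧ ∀ f : Bd K → ℝ, Integrable f ν →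
      (C : ℝ≥0∞)⁻¹ * besovSeminorm ν ε θ p f ≤ besovEnergy ν ε θ p 0 f ^ (1 / p) ∧
      besovEnergy ν ε θ p 0 f ^ (1 / p) ≤ (C : ℝ≥0∞) * besovSeminorm ν ε θ p f := by
  have hp0 : 0 < p := by linarith
  set c := ENNReal.ofReal ((2 / ε) ^ (-(θ * p))) with hc
  have hc0 : c ≠ 0 := (ENNReal.ofReal_pos.2 (by positivity)).ne'
  have hct : c ≠ ∞ := ENNReal.ofReal_ne_top
  set r := ENNReal.ofReal (Real.exp (ε * θ)) with hr
  have hr1 : 1 < r := by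
    rw [hr, ENNReal.one_lt_ofReal, Real.one_lt_exp_iff]
    positivity
  have hr0 : r ≠ 0 := (zero_lt_one.trans hr1).ne'
  have hrt : r ≠ ∞ := ENNReal.ofReal_ne_top
  have hrp0 : r ^ p ≠ 0 := (ENNReal.rpow_pos hr0.bot_lt hrt).ne'
  have hrpt : r ^ p ≠ ∞ := ENNReal.rpow_ne_top_of_nonneg hp0.le hrt
  have hrn (n : ℕ) : ENNReal.ofReal (Real.exp (ε * n * θ * p)) = (r ^ n) ^ p := by
    rw [hr, ← ENNReal.ofReal_pow (Real.exp_pos _).le, ← Real.exp_nat_mul,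
      ENNReal.ofReal_rpow_of_pos (Real.exp_pos _), ← Real.exp_mul]
    congr 2
    ring
  have hA : ∑' j, r⁻¹ ^ j ≠ ∞ := by
    rw [ENNReal.tsum_geometric]
    exact ENNReal.inv_ne_top.2 (tsub_pos_of_lt (ENNReal.inv_lt_one.2 hr1)).ne'
  set C₁ := c * (2 ^ p * (∑' j, r⁻¹ ^ j) ^ p) * (r ^ p)⁻¹
  set C₂ := r ^ p * c⁻¹
  have hC₁ : C₁ ≠ ∞ := by
    refine ENNReal.mul_ne_top (ENNReal.mul_ne_top hct (ENNReal.mul_ne_top ?_ ?_))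
      (ENNReal.inv_ne_top.2 hrp0)
    · exact ENNReal.rpow_ne_top_of_nonneg hp0.le ENNReal.ofNat_ne_top
    · exact ENNReal.rpow_ne_top_of_nonneg hp0.le hA
  have hC₂ : C₂ ≠ ∞ := ENNReal.mul_ne_top hrpt (ENNReal.inv_ne_top.2 hc0)
  have hC₁' : C₁ ^ (1 / p) ≠ ∞ := ENNReal.rpow_ne_top_of_nonneg (by positivity) hC₁
  have hC₂' : C₂ ^ (1 / p) ≠ ∞ := ENNReal.rpow_ne_top_of_nonneg (by positivity) hC₂
  set C : ℝ≥0 := max 1 (max (C₁ ^ (1 / p)).toNNReal (C₂ ^ (1 / p)).toNNReal)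
  have h1C : 1 ≤ C := le_max_left _ _
  have hC0 : (C : ℝ≥0∞) ≠ 0 := by
    exact_mod_cast (zero_lt_one.trans_le h1C).ne'
  have hle₁ : C₁ ^ (1 / p) ≤ C := by
    rw [← ENNReal.coe_toNNReal hC₁', ENNReal.coe_le_coe]
    exact (le_max_left _ _).trans (le_max_right _ _)
  have hle₂ : C₂ ^ (1 / p) ≤ C := by
    rw [← ENNReal.coe_toNNReal hC₂', ENNReal.coe_le_coe]
    exact (le_max_right _ _).trans (le_max_right _ _)
  refine ⟨C, h1C, fun f₀ hf₀ => ?_⟩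
  obtain ⟨f, hfm, hff⟩ := hf₀.aemeasurable
  have hf : Integrable f ν := hf₀.congr hff
  rw [besovSeminorm_congr hff, besovEnergy_congr hff]
  set T := ∑' n : ℕ, (r ^ n) ^ p * (K : ℝ≥0∞) ^ n * shellEnergy ν p f n
  set S := ∑' n : ℕ, (r ^ n) ^ p * ∑ w : Fin (n + 1) → Fin K,
        ν (cyl w) * ‖cylAvg ν f w - cylAvg ν f (Fin.init w)‖ₑ ^ p
  have hSem : besovSeminorm ν ε θ p f = (c * T) ^ (1 / p) := by
    rw [besovSeminorm_eq hε ν hν hp0.le hfm]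
    simp_rw [hrn]
    rfl
  have hEn : besovEnergy ν ε θ p 0 f = r ^ p * S := by
    rw [besovEnergy_zero_eq ν hp0.le, ← ENNReal.tsum_mul_left]
    refine tsum_congr fun n => ?_
    have := hrn (n + 1)
    push_cast at this
    rw [this, pow_succ', ENNReal.mul_rpow_of_nonneg _ _ hp0.le, mul_assoc]
  have hTS : T ≤ 2 ^ p * (∑' j, r⁻¹ ^ j) ^ p * S :=
    tsum_shellEnergy_le (by omega) ν hν hp hf hfm r hr0 hrt
  have hST : S ≤ T := by
    refine ENNReal.tsum_le_tsum fun n => ?_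
    rw [mul_assoc]
    exact mul_le_mul' le_rfl (sum_enorm_cylAvg_sub_rpow_le ν hν hp hf hfm n)
  rw [hSem, hEn]
  constructor
  · rw [ENNReal.inv_mul_le_iff hC0 ENNReal.coe_ne_top]
    refine (rpow_one_div_le_mul hp0 (c := C₁) ?_).trans (mul_le_mul' hle₁ le_rfl)
    calc c * T ≤ c * (2 ^ p * (∑' j, r⁻¹ ^ j) ^ p * S) := by gcongr
      _ = c * (2 ^ p * (∑' j, r⁻¹ ^ j) ^ p) * ((r ^ p)⁻¹ * r ^ p) * S := by
          rw [ENNReal.inv_mul_cancel hrp0 hrpt]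
          ring
      _ = C₁ * (r ^ p * S) := by ring
  · refine (rpow_one_div_le_mul hp0 (c := C₂) ?_).trans (mul_le_mul' hle₂ le_rfl)
    calc r ^ p * S ≤ r ^ p * T := by gcongr
      _ = r ^ p * (c⁻¹ * c) * T := by rw [ENNReal.inv_mul_cancel hc0 hct, mul_one]
      _ = C₂ * (c * T) := by ring
end

section
/- Let 0 < θ < 1 and p ≥ 1. There exists a constant C ≥ 1 such that for every f ∈ L¹(ν), C⁻¹·‖f‖_{Ḃ^θ_p} ≤ ‖f‖_{Ṅ^θ_{p,p}} ≤ C·‖f‖_{Ḃ^θ_p}; in particular the Besov seminorm is finite if and only if the Hajłasz–Besov seminorm is finite. -/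
open MeasureTheory ENNReal NNReal

open MeasureTheory ENNReal NNReal

/-- `g : ℤ → ∂X → ℝ` is a fractional `θ`-Hajłasz gradient of `f`: each `g k` is a
nonnegative measurable function, and there is a `ν`-null set `Z` such that
`|f(ζ) - f(ξ)| ≤ d(ζ,ξ)^θ (g_k(ζ) + g_k(ξ))` whenever `ζ, ξ ∉ Z` and
`2^{-k-1} ≤ d(ζ,ξ) < 2^{-k}`. -/
def IsHajlaszGrad {K : ℕ} (ν : MeasureTheory.Measure (Bd K)) (ε θ : ℝ) (f : Bd K → ℝ)
    (g : ℤ → Bd K → ℝ) : Prop :=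
  (∀ k x, 0 ≤ g k x) ∧ (∀ k, Measurable (g k)) ∧
  ∃ Z : Set (Bd K), ν Z = 0 ∧ ∀ (k : ℤ), ∀ ζ ∉ Z, ∀ ξ ∉ Z,
    (2 : ℝ) ^ (-k - 1) ≤ treeDist ε ζ ξ → treeDist ε ζ ξ < (2 : ℝ) ^ (-k) →
    |f ζ - f ξ| ≤ treeDist ε ζ ξ ^ θ * (g k ζ + g k ξ)

/-- The Hajłasz–Besov seminorm `‖f‖_{Ṅ^θ_{p,p}}`. -/
noncomputable def hajlaszSeminorm {K : ℕ} (ν : MeasureTheory.Measure (Bd K)) (ε θ p : ℝ)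
    (f : Bd K → ℝ) : ℝ≥0∞ :=
  ⨅ (g : ℤ → Bd K → ℝ) (_ : IsHajlaszGrad ν ε θ f g),
    (∑' k : ℤ, ∫⁻ x, ENNReal.ofReal (g k x ^ p) ∂ν) ^ (1 / p)

namespace TreeBoundary

open PiNat Set

variable {K : ℕ}

/-- The distance between two words whose first difference is at index `m`. -/
noncomputable def scale (ε : ℝ) (m : ℕ) : ℝ := 2 / ε * Real.exp (-(ε * m))

lemma scale_pos {ε : ℝ} (hε : 0 < ε) (m : ℕ) : 0 < scale ε m := by
  unfold scale; positivity

lemma scale_antitone {ε : ℝ} (hε : 0 < ε) : Antitone (scale ε) := by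
  intro m n hmn
  have : (m : ℝ) ≤ n := by exact_mod_cast hmn
  unfold scale
  gcongr

lemma scale_strictAnti {ε : ℝ} (hε : 0 < ε) : StrictAnti (scale ε) := by
  intro m n hmn
  have : (m : ℝ) < n := by exact_mod_cast hmn
  unfold scale
  gcongr

lemma two_mul_scale_add_le {ε : ℝ} (hε : 0 < ε) {N : ℕ} (hN : 1 ≤ ε * N) (m : ℕ) :
    2 * scale ε (m + N) ≤ scale ε m := by
  have h2 : 2 ≤ Real.exp (ε * N) := by linarith [Real.add_one_le_exp (ε * N)]
  have h : scale ε m = Real.exp (ε * N) * scale ε (m + N) := by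
    unfold scale
    rw [mul_left_comm, ← Real.exp_add]
    push_cast
    ring_nf
  rw [h]
  exact mul_le_mul_of_nonneg_right h2 (scale_pos hε _).le

/-- The `k` with `2 ^ (-k - 1) ≤ scale ε m < 2 ^ (-k)`. -/
noncomputable def dyadicIndex (ε : ℝ) (m : ℕ) : ℤ := -Int.log 2 (scale ε m) - 1

lemma dyadicIndex_eq_iff {ε : ℝ} (hε : 0 < ε) {m : ℕ} {k : ℤ} :
    dyadicIndex ε m = k ↔ (2 : ℝ) ^ (-k - 1) ≤ scale ε m ∧ scale ε m < (2 : ℝ) ^ (-k) := by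
  have h1 := Int.zpow_le_iff_le_log (b := 2) one_lt_two (x := -k - 1) (scale_pos hε m)
  have h2 := Int.lt_zpow_iff_log_lt (b := 2) one_lt_two (x := -k) (scale_pos hε m)
  rw [Nat.cast_ofNat] at h1 h2
  rw [h1, h2, dyadicIndex]
  omega

lemma dyadicIndex_mod_injective {ε : ℝ} (hε : 0 < ε) {N : ℕ} [NeZero N] (hN : 1 ≤ ε * N) :
    Function.Injective fun m : ℕ => (dyadicIndex ε m, Fin.ofNat N m) := by
  suffices h : ∀ m n : ℕ, m < n → m % N = n % N → dyadicIndex ε m ≠ dyadicIndex ε n by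
    intro m n hmn
    simp only [Prod.mk.injEq, Fin.ofNat, Fin.mk.injEq] at hmn
    by_contra hne
    rcases lt_or_gt_of_ne hne with hlt | hlt
    · exact h m n hlt hmn.2 hmn.1
    · exact h n m hlt hmn.2.symm hmn.1.symm
  intro m n hlt hmod hk
  have hle : m + N ≤ n := by
    have := Nat.le_of_dvd (Nat.sub_pos_of_lt hlt) ((Nat.modEq_iff_dvd' hlt.le).1 hmod)
    omega
  have h1 := ((dyadicIndex_eq_iff hε).1 hk).2
  have h2 := ((dyadicIndex_eq_iff hε (m := n)).1 rfl).1
  have h3 := two_mul_scale_add_le hε hN m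
  have h4 := scale_antitone hε hle
  have h5 : (2 : ℝ) ^ (-dyadicIndex ε n) = 2 * 2 ^ (-dyadicIndex ε n - 1) := by
    rw [zpow_sub_one₀ two_ne_zero]; ring
  linarith

lemma tsum_comp_dyadicIndex_le {ε : ℝ} (hε : 0 < ε) {N : ℕ} [NeZero N] (hN : 1 ≤ ε * N)
    (a : ℤ → ℝ≥0∞) : ∑' m, a (dyadicIndex ε m) ≤ N * ∑' k, a k := by
  calc ∑' m, a (dyadicIndex ε m)
      ≤ ∑' q : ℤ × Fin N, a q.1 :=
        ENNReal.tsum_comp_le_tsum_of_injective (dyadicIndex_mod_injective hε hN)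
          fun q : ℤ × Fin N => a q.1
    _ = N * ∑' k, a k := by
        rw [ENNReal.tsum_prod (f := fun k (_ : Fin N) => a k), ← ENNReal.tsum_mul_left]
        simp

lemma treeDist_of_ne (ε : ℝ) {ξ ζ : Bd K} (h : ξ ≠ ζ) :
    treeDist ε ξ ζ = scale ε (firstDiff ξ ζ) := by
  have hne : {m : ℕ | ξ m ≠ ζ m}.Nonempty := Function.ne_iff.1 h
  have hs : sInf {m : ℕ | ξ m ≠ ζ m} = firstDiff ξ ζ := by
    apply le_antisymm (Nat.sInf_le (apply_firstDiff_ne h))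
    by_contra hlt
    exact Nat.sInf_mem hne (apply_eq_of_lt_firstDiff (not_le.1 hlt))
  rw [treeDist, if_neg h, hs, scale]

lemma treeDist_ball {ε : ℝ} (hε : 0 < ε) {ζ ξ : Bd K} (h : ζ ≠ ξ) :
    {ω : Bd K | treeDist ε ζ ω ≤ treeDist ε ζ ξ} = cylinder ζ (firstDiff ζ ξ) := by
  ext ω
  rw [mem_ofPred_eq, treeDist_of_ne ε h]
  by_cases hω : ζ = ω
  · subst hω
    simp [treeDist, (scale_pos hε _).le]
  · rw [treeDist_of_ne ε hω, (scale_strictAnti hε).le_iff_ge, mem_cylinder_comm,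
      mem_cylinder_iff_le_firstDiff hω]

lemma measure_cylinder {ν : Measure (Bd K)}
    (hν : ∀ (n : ℕ) (w : Fin n → Fin K), ν (cyl w) = ((K : ℝ≥0∞) ^ n)⁻¹) (ζ : Bd K) (n : ℕ) :
    ν (cylinder ζ n) = ((K : ℝ≥0∞) ^ n)⁻¹ := by
  rw [← hν n fun i => ζ i]
  congr 1
  ext ω
  simp only [PiNat.cylinder, cyl, mem_ofPred_eq]
  exact ⟨fun h i => h i i.2, fun h i hi => h ⟨i, hi⟩⟩

lemma measurableSet_mem_cylinder (n : ℕ) :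
    MeasurableSet {q : Bd K × Bd K | q.2 ∈ cylinder q.1 n} := by
  have : {q : Bd K × Bd K | q.2 ∈ cylinder q.1 n} =
      ⋂ i : ℕ, ⋂ _ : i < n, {q | q.2 i = q.1 i} := by
    ext q; simp [PiNat.cylinder]
  rw [this]
  exact .iInter fun i => .iInter fun _ => measurableSet_eq_fun (by fun_prop) (by fun_prop)

lemma measurableSet_cylinder (ζ : Bd K) (n : ℕ) : MeasurableSet (cylinder ζ n) :=
  (measurableSet_mem_cylinder n).preimage measurable_prodMk_left

/-- The kernel `d ^ (-s) / ν(B)` of the Besov seminorm at pairs of first difference `m`. -/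
noncomputable def weight (K : ℕ) (ε s : ℝ) (m : ℕ) : ℝ≥0∞ := ENNReal.ofReal (scale ε m ^ (-s)) * (K : ℝ≥0∞) ^ m

lemma two_mul_weight_le (hK : 2 ≤ K) {ε s : ℝ} (hε : 0 < ε) (hs : 0 ≤ s) (m : ℕ) :
    2 * weight K ε s m ≤ weight K ε s (m + 1) := by
  have hK' : (2 : ℝ≥0∞) ≤ K := by exact_mod_cast hK
  have h : scale ε m ^ (-s) ≤ scale ε (m + 1) ^ (-s) :=
    Real.rpow_le_rpow_of_nonpos (scale_pos hε _) (scale_antitone hε m.le_succ) (by linarith)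
  calc 2 * weight K ε s m = ENNReal.ofReal (scale ε m ^ (-s)) * (K ^ m * 2) := by
        rw [weight]; ring
    _ ≤ ENNReal.ofReal (scale ε (m + 1) ^ (-s)) * (K ^ m * K) := by gcongr
    _ = weight K ε s (m + 1) := by rw [weight, pow_succ]

lemma sum_weight_le (hK : 2 ≤ K) {ε s : ℝ} (hε : 0 < ε) (hs : 0 ≤ s) (n : ℕ) :
    ∑ m ∈ Finset.range (n + 1), weight K ε s m ≤ 2 * weight K ε s n := by
  induction n with
  | zero => simpa using le_mul_of_one_le_left' (one_le_two : (1 : ℝ≥0∞) ≤ 2)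
  | succ n ih =>
    rw [Finset.sum_range_succ, two_mul]
    gcongr
    exact ih.trans (two_mul_weight_le hK hε hs n)

/-- The `p`-th power of the oscillation of `f` between two points. -/
noncomputable def oscPow (p : ℝ) (f : Bd K → ℝ) (ζ ξ : Bd K) : ℝ≥0∞ := ENNReal.ofReal (|f ζ - f ξ| ^ p)

lemma ofReal_add_rpow_le {p a b : ℝ} (hp : 1 ≤ p) (ha : 0 ≤ a) (hb : 0 ≤ b) :
    ENNReal.ofReal ((a + b) ^ p) ≤
      2 ^ (p - 1) * (ENNReal.ofReal (a ^ p) + ENNReal.ofReal (b ^ p)) := by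
  have hp0 : 0 ≤ p := by linarith
  rw [← ENNReal.ofReal_rpow_of_nonneg (add_nonneg ha hb) hp0, ENNReal.ofReal_add ha hb,
    ← ENNReal.ofReal_rpow_of_nonneg ha hp0, ← ENNReal.ofReal_rpow_of_nonneg hb hp0]
  exact ENNReal.rpow_add_le_mul_rpow_add_rpow _ _ hp

lemma oscPow_le_add {p : ℝ} (hp : 1 ≤ p) (f : Bd K → ℝ) (ζ ξ η : Bd K) :
    oscPow p f ζ ξ ≤ 2 ^ (p - 1) * (oscPow p f ζ η + oscPow p f ξ η) := by
  refine le_trans ?_ (ofReal_add_rpow_le hp (abs_nonneg _) (abs_nonneg _))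
  refine ENNReal.ofReal_le_ofReal (Real.rpow_le_rpow (abs_nonneg _) ?_ (by linarith))
  rw [abs_sub_comm (f ξ)]
  exact abs_sub_le _ _ _

lemma measurable_oscPow {p : ℝ} {f : Bd K → ℝ} (hf : Measurable f) :
    Measurable fun q : Bd K × Bd K => oscPow p f q.1 q.2 := by
  unfold oscPow; fun_prop

open Classical in
/-- The integrand of the Besov seminorm in terms of `weight` and `oscPow`. -/
noncomputable def besovKernel (ε s p : ℝ) (f : Bd K → ℝ) (ζ ξ : Bd K) : ℝ≥0∞ :=
  if ζ = ξ then 0 else weight K ε s (firstDiff ζ ξ) * oscPow p f ζ ξ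

lemma besovSeminorm_eq {ν : Measure (Bd K)}
    (hν : ∀ (n : ℕ) (w : Fin n → Fin K), ν (cyl w) = ((K : ℝ≥0∞) ^ n)⁻¹)
    {ε : ℝ} (hε : 0 < ε) (θ p : ℝ) (f : Bd K → ℝ) :
    besovSeminorm ν ε θ p f = (∫⁻ ζ, ∫⁻ ξ, besovKernel ε (θ * p) p f ζ ξ ∂ν ∂ν) ^ (1 / p) := by
  unfold besovSeminorm besovKernel
  congr! 5 with ζ ξ
  split_ifs with h
  · rfl
  have hr := scale_pos hε (firstDiff ζ ξ)
  rw [treeDist_ball hε h, measure_cylinder hν, treeDist_of_ne ε h, div_eq_mul_inv, inv_inv,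
    div_eq_mul_inv, ← Real.rpow_neg hr.le, ENNReal.ofReal_mul' (by positivity), weight, oscPow]
  ring

/-- The level `m` part of the Besov energy at `ζ`, averaged over the whole cylinder. -/
noncomputable def levelEnergy (ν : Measure (Bd K)) (ε s p : ℝ) (f : Bd K → ℝ) (m : ℕ) (ζ : Bd K) : ℝ≥0∞ :=
  ∫⁻ η, (cylinder ζ m).indicator (fun η => weight K ε s m * oscPow p f ζ η) η ∂ν

lemma measurable_levelIntegrand (ε s p : ℝ) {f : Bd K → ℝ} (hf : Measurable f) (m : ℕ) :
    Measurable fun q : Bd K × Bd K =>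
      (cylinder q.1 m).indicator (fun η => weight K ε s m * oscPow p f q.1 η) q.2 :=
  ((measurable_oscPow hf).const_mul (weight K ε s m)).indicator (measurableSet_mem_cylinder m)

lemma measurable_levelEnergy (ν : Measure (Bd K)) [SFinite ν] (ε s p : ℝ) {f : Bd K → ℝ}
    (hf : Measurable f) (m : ℕ) : Measurable (levelEnergy ν ε s p f m) :=
  (measurable_levelIntegrand ε s p hf m).lintegral_prod_right'

lemma tsum_levelIntegrand_le (hK : 2 ≤ K) {ε s p : ℝ} (hε : 0 < ε) (hs : 0 ≤ s) (hp : 0 < p)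
    (f : Bd K → ℝ) (ζ η : Bd K) :
    ∑' m, (cylinder ζ m).indicator (fun η => weight K ε s m * oscPow p f ζ η) η ≤
      2 * besovKernel ε s p f ζ η := by
  by_cases h : ζ = η
  · subst h
    simp [oscPow, Real.zero_rpow hp.ne', indicator]
  rw [besovKernel, if_neg h, tsum_eq_sum (s := Finset.range (firstDiff ζ η + 1))]
  · calc ∑ m ∈ Finset.range (firstDiff ζ η + 1),
          (cylinder ζ m).indicator (fun η => weight K ε s m * oscPow p f ζ η) η
        ≤ ∑ m ∈ Finset.range (firstDiff ζ η + 1), weight K ε s m * oscPow p f ζ η :=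
          Finset.sum_le_sum fun m _ => indicator_le_self' (fun _ _ => zero_le) η
      _ ≤ 2 * weight K ε s (firstDiff ζ η) * oscPow p f ζ η := by
          rw [← Finset.sum_mul]
          gcongr
          exact sum_weight_le hK hε hs _
      _ = _ := mul_assoc _ _ _
  · intro m hm
    refine indicator_of_notMem ?_ _
    rw [mem_cylinder_comm, mem_cylinder_iff_le_firstDiff h]
    simpa using hm

lemma lintegral_tsum_levelEnergy_le (hK : 2 ≤ K) (ν : Measure (Bd K)) [SFinite ν] {ε s p : ℝ}
    (hε : 0 < ε) (hs : 0 ≤ s) (hp : 0 < p) {f : Bd K → ℝ} (hf : Measurable f) :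
    ∫⁻ ζ, ∑' m, levelEnergy ν ε s p f m ζ ∂ν ≤
      2 * ∫⁻ ζ, ∫⁻ η, besovKernel ε s p f ζ η ∂ν ∂ν := by
  simp only [← lintegral_const_mul' 2 _ ENNReal.ofNat_ne_top]
  refine lintegral_mono fun ζ => ?_
  unfold levelEnergy
  have hmeas : ∀ m, Measurable fun η =>
      (cylinder ζ m).indicator (fun η => weight K ε s m * oscPow p f ζ η) η :=
    fun m => (measurable_levelIntegrand ε s p hf m).comp measurable_prodMk_left
  rw [← lintegral_tsum fun m => (hmeas m).aemeasurable]
  exact lintegral_mono fun η => tsum_levelIntegrand_le hK hε hs hp f ζ η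

lemma ofReal_mul_oscPow_le (hK : 2 ≤ K) {ν : Measure (Bd K)} [SFinite ν]
    (hν : ∀ (n : ℕ) (w : Fin n → Fin K), ν (cyl w) = ((K : ℝ≥0∞) ^ n)⁻¹)
    {p : ℝ} (hp : 1 ≤ p) (ε s : ℝ) {f : Bd K → ℝ} (hf : Measurable f)
    (ζ ξ : Bd K) :
    ENNReal.ofReal (scale ε (firstDiff ζ ξ) ^ (-s)) * oscPow p f ζ ξ ≤
      2 ^ (p - 1) * (levelEnergy ν ε s p f (firstDiff ζ ξ) ζ +
        levelEnergy ν ε s p f (firstDiff ζ ξ) ξ) := by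
  set m := firstDiff ζ ξ
  have hc : cylinder ξ m = cylinder ζ m := (cylinder_eq_cylinder_of_le_firstDiff ζ ξ le_rfl).symm
  have hmeas : ∀ ω, Measurable fun η => oscPow p f ω η := fun ω =>
    (measurable_oscPow hf).comp measurable_prodMk_left
  have hE : ∀ ω, levelEnergy ν ε s p f m ω =
      weight K ε s m * ∫⁻ η in cylinder ω m, oscPow p f ω η ∂ν := fun ω => by
    rw [levelEnergy, lintegral_indicator (measurableSet_cylinder ω m),
      lintegral_const_mul _ (hmeas ω)]
  have hK0 : ((K : ℝ≥0∞) ^ m) ≠ 0 := pow_ne_zero _ (by simp; omega)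
  have hKt : ((K : ℝ≥0∞) ^ m) ≠ ⊤ := ENNReal.pow_ne_top (ENNReal.natCast_ne_top K)
  have hconst : oscPow p f ζ ξ = K ^ m * ∫⁻ _ in cylinder ζ m, oscPow p f ζ ξ ∂ν := by
    rw [setLIntegral_const, measure_cylinder hν, mul_left_comm, ENNReal.mul_inv_cancel hK0 hKt,
      mul_one]
  rw [hE, hE, hc, ← mul_add, ← lintegral_add_left (hmeas ζ), hconst, weight]
  calc _ ≤ ENNReal.ofReal (scale ε m ^ (-s)) * (K ^ m * ∫⁻ η in cylinder ζ m,
          2 ^ (p - 1) * (oscPow p f ζ η + oscPow p f ξ η) ∂ν) := by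
        gcongr with η
        exact oscPow_le_add hp f ζ ξ η
    _ = _ := by
        have hadd : Measurable fun η => oscPow p f ζ η + oscPow p f ξ η := (hmeas ζ).add (hmeas ξ)
        rw [lintegral_const_mul _ hadd]
        ring

/-- The sum of the level energies over the levels of dyadic index `k`. -/
noncomputable def dyadicEnergy (ν : Measure (Bd K)) (ε s p : ℝ) (f : Bd K → ℝ) (k : ℤ) (ζ : Bd K) : ℝ≥0∞ :=
  ∑' m, if k = dyadicIndex ε m then levelEnergy ν ε s p f m ζ else 0

lemma measurable_dyadicEnergy (ν : Measure (Bd K)) [SFinite ν] (ε s p : ℝ) {f : Bd K → ℝ}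
    (hf : Measurable f) (k : ℤ) : Measurable (dyadicEnergy ν ε s p f k) := by
  refine Measurable.tsum fun m => ?_
  split_ifs
  · exact measurable_levelEnergy ν ε s p hf m
  · exact measurable_const

lemma tsum_dyadicEnergy (ν : Measure (Bd K)) (ε s p : ℝ) (f : Bd K → ℝ) (ζ : Bd K) :
    ∑' k, dyadicEnergy ν ε s p f k ζ = ∑' m, levelEnergy ν ε s p f m ζ := by
  unfold dyadicEnergy
  rw [ENNReal.tsum_comm]
  simp only [tsum_ite_eq]

lemma levelEnergy_le_dyadicEnergy (ν : Measure (Bd K)) (ε s p : ℝ) (f : Bd K → ℝ) (m : ℕ)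
    (ζ : Bd K) : levelEnergy ν ε s p f m ζ ≤ dyadicEnergy ν ε s p f (dyadicIndex ε m) ζ := by
  simpa [dyadicEnergy] using ENNReal.le_tsum (f := fun n => if dyadicIndex ε m = dyadicIndex ε n then
    levelEnergy ν ε s p f n ζ else 0) m

/-- The fractional Hajłasz gradient built from the dyadic energies. -/
noncomputable def energyGrad (ν : Measure (Bd K)) (ε s p : ℝ) (f : Bd K → ℝ) (k : ℤ) (ζ : Bd K) : ℝ :=
  (2 ^ (p - 1) * dyadicEnergy ν ε s p f k ζ).toReal ^ (1 / p)

lemma abs_sub_le_energyGrad (hK : 2 ≤ K) {ν : Measure (Bd K)} [SFinite ν]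
    (hν : ∀ (n : ℕ) (w : Fin n → Fin K), ν (cyl w) = ((K : ℝ≥0∞) ^ n)⁻¹)
    {ε : ℝ} (hε : 0 < ε) {p : ℝ} (hp : 1 ≤ p) (θ : ℝ) {f : Bd K → ℝ} (hf : Measurable f)
    {ζ ξ : Bd K} {k : ℤ} (hk : dyadicIndex ε (firstDiff ζ ξ) = k)
    (hζ : dyadicEnergy ν ε (θ * p) p f k ζ ≠ ⊤) (hξ : dyadicEnergy ν ε (θ * p) p f k ξ ≠ ⊤) :
    |f ζ - f ξ| ≤ scale ε (firstDiff ζ ξ) ^ θ *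
      (energyGrad ν ε (θ * p) p f k ζ + energyGrad ν ε (θ * p) p f k ξ) := by
  set r := scale ε (firstDiff ζ ξ)
  have hr : 0 < r := scale_pos hε _
  have hp0 : 0 < p := by linarith
  have hc : (2 : ℝ≥0∞) ^ (p - 1) ≠ ⊤ := ENNReal.rpow_ne_top_of_nonneg (by linarith) (by simp)
  set a := 2 ^ (p - 1) * dyadicEnergy ν ε (θ * p) p f k ζ
  set b := 2 ^ (p - 1) * dyadicEnergy ν ε (θ * p) p f k ξ
  have ha : a ≠ ⊤ := ENNReal.mul_ne_top hc hζ
  have hb : b ≠ ⊤ := ENNReal.mul_ne_top hc hξ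
  have h : ENNReal.ofReal ((r ^ (-θ) * |f ζ - f ξ|) ^ p) ≤ a + b := by
    rw [Real.mul_rpow (by positivity) (abs_nonneg _), ← Real.rpow_mul hr.le, neg_mul,
      ENNReal.ofReal_mul (by positivity)]
    refine (ofReal_mul_oscPow_le hK hν hp ε (θ * p) hf ζ ξ).trans ?_
    rw [mul_add]
    simp only [a, b, ← hk]
    gcongr <;> exact levelEnergy_le_dyadicEnergy ..
  rw [← ENNReal.ofReal_toReal (ENNReal.add_ne_top.2 ⟨ha, hb⟩),
    ENNReal.ofReal_le_ofReal_iff ENNReal.toReal_nonneg, ENNReal.toReal_add ha hb] at h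
  have h1 : r ^ (-θ) * |f ζ - f ξ| ≤ a.toReal ^ (1 / p) + b.toReal ^ (1 / p) := by
    refine le_trans ?_ (Real.rpow_add_le_add_rpow ENNReal.toReal_nonneg ENNReal.toReal_nonneg
      (by positivity) (by rw [div_le_one hp0]; exact hp))
    rw [one_div]
    exact (Real.le_rpow_inv_iff_of_pos (by positivity) (by positivity) hp0).2 h
  rwa [Real.rpow_neg hr.le, inv_mul_le_iff₀ (by positivity)] at h1

lemma isHajlaszGrad_energyGrad (hK : 2 ≤ K) {ν : Measure (Bd K)} [SFinite ν]
    (hν : ∀ (n : ℕ) (w : Fin n → Fin K), ν (cyl w) = ((K : ℝ≥0∞) ^ n)⁻¹)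
    {ε : ℝ} (hε : 0 < ε) {p θ : ℝ} (hp : 1 ≤ p) (hθ : 0 ≤ θ) {f : Bd K → ℝ} (hf : Measurable f)
    (hfin : ∫⁻ ζ, ∫⁻ η, besovKernel ε (θ * p) p f ζ η ∂ν ∂ν ≠ ⊤) :
    IsHajlaszGrad ν ε θ f (energyGrad ν ε (θ * p) p f) := by
  have hp0 : 0 < p := by linarith
  have hmeas := fun k => measurable_dyadicEnergy ν ε (θ * p) p hf k
  refine ⟨fun k x => by unfold energyGrad; positivity, fun k => ?_, ?_⟩
  · unfold energyGrad
    exact ((hmeas k).const_mul _).ennreal_toReal.pow_const _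
  have hae : ∀ᵐ ζ ∂ν, ∑' k, dyadicEnergy ν ε (θ * p) p f k ζ < ⊤ := by
    refine ae_lt_top (Measurable.tsum hmeas) (ne_top_of_le_ne_top ?_
      ((lintegral_congr fun ζ => tsum_dyadicEnergy ν ε (θ * p) p f ζ).trans_le
        (lintegral_tsum_levelEnergy_le hK ν hε (by positivity) hp0 hf)))
    exact ENNReal.mul_ne_top (by simp) hfin
  refine ⟨_, hae, fun k ζ hζ ξ hξ h1 h2 => ?_⟩
  simp only [mem_compl_iff, mem_ofPred_eq, not_not] at hζ hξ
  have hne : ζ ≠ ξ := by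
    rintro rfl
    have : (0 : ℝ) < 2 ^ (-k - 1) := by positivity
    simp only [treeDist, if_true] at h1
    linarith
  rw [treeDist_of_ne ε hne] at h1 h2 ⊢
  exact abs_sub_le_energyGrad hK hν hε hp θ hf ((dyadicIndex_eq_iff hε).2 ⟨h1, h2⟩)
    ((ENNReal.le_tsum k).trans_lt hζ).ne ((ENNReal.le_tsum k).trans_lt hξ).ne

lemma tsum_lintegral_energyGrad_le (hK : 2 ≤ K) (ν : Measure (Bd K)) [SFinite ν]
    {ε : ℝ} (hε : 0 < ε) {p θ : ℝ} (hp : 1 ≤ p) (hθ : 0 ≤ θ) {f : Bd K → ℝ} (hf : Measurable f) :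
    ∑' k, ∫⁻ x, ENNReal.ofReal (energyGrad ν ε (θ * p) p f k x ^ p) ∂ν ≤
      2 * 2 ^ (p - 1) * ∫⁻ ζ, ∫⁻ η, besovKernel ε (θ * p) p f ζ η ∂ν ∂ν := by
  have hp0 : 0 < p := by linarith
  have hmeas := fun k => measurable_dyadicEnergy ν ε (θ * p) p hf k
  calc ∑' k, ∫⁻ x, ENNReal.ofReal (energyGrad ν ε (θ * p) p f k x ^ p) ∂ν
      ≤ ∑' k, ∫⁻ x, 2 ^ (p - 1) * dyadicEnergy ν ε (θ * p) p f k x ∂ν := by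
        gcongr with k x
        rw [energyGrad, ← Real.rpow_mul ENNReal.toReal_nonneg, one_div_mul_cancel hp0.ne',
          Real.rpow_one]
        exact ENNReal.ofReal_toReal_le
    _ = 2 ^ (p - 1) * ∫⁻ x, ∑' m, levelEnergy ν ε (θ * p) p f m x ∂ν := by
        simp only [← tsum_dyadicEnergy]
        rw [lintegral_tsum fun k => (hmeas k).aemeasurable, ← ENNReal.tsum_mul_left]
        exact tsum_congr fun k => lintegral_const_mul _ (hmeas k)
    _ ≤ 2 ^ (p - 1) * (2 * ∫⁻ ζ, ∫⁻ η, besovKernel ε (θ * p) p f ζ η ∂ν ∂ν) := by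
        gcongr
        exact lintegral_tsum_levelEnergy_le hK ν hε (by positivity) hp0 hf
    _ = _ := by ring

lemma besovSeminorm_congr_ae {ν : Measure (Bd K)} {f f' : Bd K → ℝ} (h : f =ᵐ[ν] f')
    (ε θ p : ℝ) : besovSeminorm ν ε θ p f = besovSeminorm ν ε θ p f' := by
  unfold besovSeminorm
  congr 1
  refine lintegral_congr_ae (h.mono fun ζ hζ => lintegral_congr_ae (h.mono fun ξ hξ => ?_))
  simp only [hζ, hξ]

lemma IsHajlaszGrad.congr_ae {ν : Measure (Bd K)} {f f' : Bd K → ℝ} (h : f =ᵐ[ν] f')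
    {ε θ : ℝ} {g : ℤ → Bd K → ℝ} (hg : IsHajlaszGrad ν ε θ f g) :
    IsHajlaszGrad ν ε θ f' g := by
  obtain ⟨h0, hm, Z, hZ, hle⟩ := hg
  refine ⟨h0, hm, Z ∪ {x | f x = f' x}ᶜ, measure_union_null hZ h, fun k ζ hζ ξ hξ h1 h2 => ?_⟩
  simp only [mem_union, mem_compl_iff, mem_ofPred_eq, not_or, not_not] at hζ hξ
  rw [← hζ.2, ← hξ.2]
  exact hle k ζ hζ.1 ξ hξ.1 h1 h2

lemma hajlaszSeminorm_le (hK : 2 ≤ K) {ν : Measure (Bd K)} [SFinite ν]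
    (hν : ∀ (n : ℕ) (w : Fin n → Fin K), ν (cyl w) = ((K : ℝ≥0∞) ^ n)⁻¹)
    {ε : ℝ} (hε : 0 < ε) {p θ : ℝ} (hp : 1 ≤ p) (hθ : 0 ≤ θ) {f : Bd K → ℝ}
    (hf : AEMeasurable f ν) :
    hajlaszSeminorm ν ε θ p f ≤ (2 * 2 ^ (p - 1)) ^ (1 / p) * besovSeminorm ν ε θ p f := by
  have hp0 : 0 < p := by linarith
  rw [besovSeminorm_congr_ae hf.ae_eq_mk, besovSeminorm_eq hν hε,
    ← ENNReal.mul_rpow_of_nonneg _ _ (by positivity)]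
  by_cases hfin : ∫⁻ ζ, ∫⁻ η, besovKernel ε (θ * p) p (hf.mk f) ζ η ∂ν ∂ν = ⊤
  · rw [hfin, ENNReal.mul_top (by simp), ENNReal.top_rpow_of_pos (by positivity)]
    exact le_top
  refine (iInf₂_le _ (IsHajlaszGrad.congr_ae hf.ae_eq_mk.symm
    (isHajlaszGrad_energyGrad hK hν hε hp hθ hf.measurable_mk hfin))).trans ?_
  gcongr
  exact tsum_lintegral_energyGrad_le hK ν hε hp hθ hf.measurable_mk

lemma besovKernel_le_of_abs_sub_le {ε : ℝ} (hε : 0 < ε) {p : ℝ} (hp : 1 ≤ p) (θ : ℝ)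
    {f : Bd K → ℝ} {ζ ξ : Bd K} {a b : ℝ} (ha : 0 ≤ a) (hb : 0 ≤ b)
    (h : |f ζ - f ξ| ≤ scale ε (firstDiff ζ ξ) ^ θ * (a + b)) :
    besovKernel ε (θ * p) p f ζ ξ ≤ K ^ firstDiff ζ ξ *
      (2 ^ (p - 1) * (ENNReal.ofReal (a ^ p) + ENNReal.ofReal (b ^ p))) := by
  unfold besovKernel
  split_ifs
  · exact zero_le
  set m := firstDiff ζ ξ
  have hr := scale_pos hε m
  rw [weight, mul_right_comm, mul_comm]
  refine mul_le_mul_right ?_ _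
  refine le_trans ?_ (ofReal_add_rpow_le hp ha hb)
  rw [oscPow, ← ENNReal.ofReal_mul (by positivity)]
  apply ENNReal.ofReal_le_ofReal
  rw [Real.rpow_neg hr.le, inv_mul_le_iff₀ (by positivity), Real.rpow_mul hr.le,
    ← Real.mul_rpow (by positivity) (by positivity)]
  exact Real.rpow_le_rpow (abs_nonneg _) h (by linarith)

lemma lintegral_lintegral_indicator_cylinder_le {ν : Measure (Bd K)} [SFinite ν]
    (hν : ∀ (n : ℕ) (w : Fin n → Fin K), ν (cyl w) = ((K : ℝ≥0∞) ^ n)⁻¹) (m : ℕ)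
    {γ : Bd K → ℝ≥0∞} (hγ : Measurable γ) :
    ∫⁻ ζ, ∫⁻ ξ, (cylinder ζ m).indicator (fun ξ => (K : ℝ≥0∞) ^ m * (γ ζ + γ ξ)) ξ ∂ν ∂ν ≤
      2 * ∫⁻ ζ, γ ζ ∂ν := by
  have hm : Measurable fun q : Bd K × Bd K =>
      (cylinder q.1 m).indicator (fun _ => (K : ℝ≥0∞) ^ m * γ q.1) q.2 :=
    Measurable.indicator (f := fun q : Bd K × Bd K => (K : ℝ≥0∞) ^ m * γ q.1) (by fun_prop)
      (measurableSet_mem_cylinder m)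
  have hone : ∫⁻ ζ, ∫⁻ ξ, (cylinder ζ m).indicator (fun _ => (K : ℝ≥0∞) ^ m * γ ζ) ξ ∂ν ∂ν ≤
      ∫⁻ ζ, γ ζ ∂ν := by
    refine lintegral_mono fun ζ => ?_
    rw [lintegral_indicator (measurableSet_cylinder ζ m), setLIntegral_const,
      measure_cylinder hν, mul_right_comm]
    exact mul_le_of_le_one_left' (ENNReal.mul_inv_le_one _)
  have hsymm : ∀ ζ ξ, (cylinder ζ m).indicator (fun ξ => (K : ℝ≥0∞) ^ m * (γ ζ + γ ξ)) ξ =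
      (cylinder ζ m).indicator (fun _ => (K : ℝ≥0∞) ^ m * γ ζ) ξ +
      (cylinder ξ m).indicator (fun _ => (K : ℝ≥0∞) ^ m * γ ξ) ζ := fun ζ ξ => by
    by_cases h : ξ ∈ cylinder ζ m
    · simp [h, (mem_cylinder_comm ζ ξ m).1 h, mul_add]
    · simp [h, mt (mem_cylinder_comm ζ ξ m).2 h]
  simp only [hsymm]
  calc _ = ∫⁻ ζ, (∫⁻ ξ, (cylinder ζ m).indicator (fun _ => (K : ℝ≥0∞) ^ m * γ ζ) ξ ∂ν +
          ∫⁻ ξ, (cylinder ξ m).indicator (fun _ => (K : ℝ≥0∞) ^ m * γ ξ) ζ ∂ν) ∂ν :=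
        lintegral_congr fun ζ => lintegral_add_left (hm.comp measurable_prodMk_left) _
    _ = ∫⁻ ζ, ∫⁻ ξ, (cylinder ζ m).indicator (fun _ => (K : ℝ≥0∞) ^ m * γ ζ) ξ ∂ν ∂ν +
          ∫⁻ ζ, ∫⁻ ξ, (cylinder ξ m).indicator (fun _ => (K : ℝ≥0∞) ^ m * γ ξ) ζ ∂ν ∂ν :=
        lintegral_add_left hm.lintegral_prod_right' _
    _ ≤ 2 * ∫⁻ ζ, γ ζ ∂ν := by
        rw [two_mul]
        refine add_le_add hone ?_
        exact (lintegral_lintegral_swap (f := fun ζ ξ =>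
          (cylinder ξ m).indicator (fun _ => (K : ℝ≥0∞) ^ m * γ ξ) ζ)
          (hm.comp measurable_swap).aemeasurable).trans_le hone

lemma lintegral_besovKernel_le {ν : Measure (Bd K)} [SFinite ν]
    (hν : ∀ (n : ℕ) (w : Fin n → Fin K), ν (cyl w) = ((K : ℝ≥0∞) ^ n)⁻¹)
    {ε : ℝ} (hε : 0 < ε) {N : ℕ} [NeZero N] (hN : 1 ≤ ε * N) {p θ : ℝ} (hp : 1 ≤ p)
    {f : Bd K → ℝ} {g : ℤ → Bd K → ℝ} (hg : IsHajlaszGrad ν ε θ f g) :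
    ∫⁻ ζ, ∫⁻ ξ, besovKernel ε (θ * p) p f ζ ξ ∂ν ∂ν ≤
      2 * 2 ^ (p - 1) * N * ∑' k, ∫⁻ x, ENNReal.ofReal (g k x ^ p) ∂ν := by
  obtain ⟨h0, hm, Z, hZ, hle⟩ := hg
  have hc : (2 : ℝ≥0∞) ^ (p - 1) ≠ ⊤ := ENNReal.rpow_ne_top_of_nonneg (by linarith) (by simp)
  set γ : ℕ → Bd K → ℝ≥0∞ := fun m x => ENNReal.ofReal (g (dyadicIndex ε m) x ^ p) with hγ
  have hγm : ∀ m, Measurable (γ m) := fun m => ((hm _).pow_const p).ennreal_ofReal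
  set F : ℕ → Bd K → Bd K → ℝ≥0∞ := fun m ζ =>
    (cylinder ζ m).indicator fun ξ => (K : ℝ≥0∞) ^ m * (γ m ζ + γ m ξ) with hF
  have hFm : ∀ m, Measurable fun q : Bd K × Bd K => F m q.1 q.2 := fun m =>
    Measurable.indicator (f := fun q : Bd K × Bd K => (K : ℝ≥0∞) ^ m * (γ m q.1 + γ m q.2))
      (by fun_prop) (measurableSet_mem_cylinder m)
  have hZae : ∀ᵐ ζ ∂ν, ζ ∉ Z := measure_eq_zero_iff_ae_notMem.1 hZ
  have hkernel : ∀ ζ ∉ Z, ∀ ξ ∉ Z,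
      besovKernel ε (θ * p) p f ζ ξ ≤ 2 ^ (p - 1) * ∑' m, F m ζ ξ := by
    intro ζ hζ ξ hξ
    by_cases h : ζ = ξ
    · simp [besovKernel, h]
    obtain ⟨h1, h2⟩ := (dyadicIndex_eq_iff hε (m := firstDiff ζ ξ)).1 rfl
    rw [← treeDist_of_ne ε h] at h1 h2
    have h3 := hle _ ζ hζ ξ hξ h1 h2
    rw [treeDist_of_ne ε h] at h3
    calc _ ≤ _ := besovKernel_le_of_abs_sub_le hε hp θ (h0 _ _) (h0 _ _) h3
      _ = 2 ^ (p - 1) * F (firstDiff ζ ξ) ζ ξ := by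
          rw [hF]
          simp only
          rw [indicator_of_mem ((mem_cylinder_comm _ _ _).1 (mem_cylinder_firstDiff ζ ξ))]
          ring
      _ ≤ _ := by gcongr; exact ENNReal.le_tsum (f := fun m => F m ζ ξ) _
  calc ∫⁻ ζ, ∫⁻ ξ, besovKernel ε (θ * p) p f ζ ξ ∂ν ∂ν
      ≤ ∫⁻ ζ, ∫⁻ ξ, 2 ^ (p - 1) * ∑' m, F m ζ ξ ∂ν ∂ν :=
        lintegral_mono_ae (hZae.mono fun ζ hζ =>
          lintegral_mono_ae (hZae.mono fun ξ hξ => hkernel ζ hζ ξ hξ))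
    _ = 2 ^ (p - 1) * ∑' m, ∫⁻ ζ, ∫⁻ ξ, F m ζ ξ ∂ν ∂ν := by
        simp only [lintegral_const_mul' _ _ hc]
        rw [← lintegral_tsum fun m => (hFm m).lintegral_prod_right'.aemeasurable]
        congr 1
        exact lintegral_congr fun ζ =>
          lintegral_tsum fun m => ((hFm m).comp measurable_prodMk_left).aemeasurable
    _ ≤ 2 ^ (p - 1) * ∑' m, 2 * ∫⁻ x, γ m x ∂ν := by
        gcongr with m
        exact lintegral_lintegral_indicator_cylinder_le hν m (hγm m)
    _ ≤ 2 ^ (p - 1) * (2 * (N * ∑' k, ∫⁻ x, ENNReal.ofReal (g k x ^ p) ∂ν)) := by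
        rw [ENNReal.tsum_mul_left]
        gcongr
        exact tsum_comp_dyadicIndex_le hε hN fun k => ∫⁻ x, ENNReal.ofReal (g k x ^ p) ∂ν
    _ = _ := by ring

lemma besovSeminorm_le {ν : Measure (Bd K)} [SFinite ν]
    (hν : ∀ (n : ℕ) (w : Fin n → Fin K), ν (cyl w) = ((K : ℝ≥0∞) ^ n)⁻¹)
    {ε : ℝ} (hε : 0 < ε) {N : ℕ} [NeZero N] (hN : 1 ≤ ε * N) {p : ℝ} (θ : ℝ) (hp : 1 ≤ p)
    (f : Bd K → ℝ) {c : ℝ≥0∞} (hc : (2 * 2 ^ (p - 1) * N) ^ (1 / p) ≤ c) (hc0 : c ≠ 0)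
    (hct : c ≠ ⊤) :
    c⁻¹ * besovSeminorm ν ε θ p f ≤ hajlaszSeminorm ν ε θ p f := by
  have hp0 : 0 < p := by linarith
  refine le_iInf₂ fun g hg => ?_
  rw [ENNReal.inv_mul_le_iff hc0 hct, besovSeminorm_eq hν hε]
  calc _ ≤ (2 * 2 ^ (p - 1) * N * ∑' k, ∫⁻ x, ENNReal.ofReal (g k x ^ p) ∂ν) ^ (1 / p) := by
        gcongr
        exact lintegral_besovKernel_le hν hε hN hp hg
    _ ≤ _ := by
        rw [ENNReal.mul_rpow_of_nonneg _ _ (by positivity)]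
        gcongr

end TreeBoundary

/-- For `0 < θ < 1` and `p ≥ 1`, the Besov seminorm `‖f‖_{Ḃ^θ_p}` and the
Hajłasz–Besov seminorm `‖f‖_{Ṅ^θ_{p,p}}` are comparable for all `f ∈ L¹(ν)`;
in particular one is finite iff the other is. -/
theorem statement7 (K : ℕ) (hK : 2 ≤ K) (ε : ℝ) (hε : 0 < ε)
    (ν : Measure (Bd K)) (hprob : IsProbabilityMeasure ν)
    (hν : ∀ (n : ℕ) (w : Fin n → Fin K), ν (cyl w) = ((K : ℝ≥0∞) ^ n)⁻¹)
    (p θ : ℝ) (hp : 1 ≤ p) (hθ0 : 0 < θ) (hθ1 : θ < 1) :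
    ∃ C : ℝ≥0, 1 ≤ C ∧ ∀ f : Bd K → ℝ, Integrable f ν →
      (C : ℝ≥0∞)⁻¹ * besovSeminorm ν ε θ p f ≤ hajlaszSeminorm ν ε θ p f ∧
      hajlaszSeminorm ν ε θ p f ≤ (C : ℝ≥0∞) * besovSeminorm ν ε θ p f := by
  obtain ⟨N, hN⟩ := exists_nat_ge (1 / ε)
  have hN0 : N ≠ 0 := by
    rintro rfl
    have : 0 < 1 / ε := by positivity
    norm_num at hN
    linarith
  have : NeZero N := ⟨hN0⟩
  rw [div_le_iff₀' hε] at hN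
  set A : ℝ≥0∞ := 2 * 2 ^ (p - 1) * N with hA
  have hN1 : (1 : ℝ≥0∞) ≤ N := by exact_mod_cast Nat.one_le_iff_ne_zero.2 hN0
  have h2 : (1 : ℝ≥0∞) ≤ 2 ^ (p - 1) := by
    simpa using ENNReal.rpow_le_rpow one_le_two (sub_nonneg.2 hp)
  have hBA : 2 * 2 ^ (p - 1) ≤ A := le_mul_of_one_le_right' hN1
  have hA1 : 1 ≤ A := (one_le_mul one_le_two h2).trans hBA
  have hAt : A ≠ ⊤ := by
    have : (2 : ℝ≥0∞) ^ (p - 1) ≠ ⊤ := ENNReal.rpow_ne_top_of_nonneg (by linarith) (by simp)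
    finiteness
  have hAp : A ^ (1 / p) ≤ A := by
    conv_rhs => rw [← ENNReal.rpow_one A]
    exact ENNReal.rpow_le_rpow_of_exponent_le hA1 (by rw [div_le_one (by linarith)]; exact hp)
  refine ⟨A.toNNReal, ?_, fun f hf => ?_⟩
  · rw [← ENNReal.coe_le_coe, ENNReal.coe_toNNReal hAt]
    exact hA1
  rw [ENNReal.coe_toNNReal hAt]
  refine ⟨TreeBoundary.besovSeminorm_le hν hε hN θ hp f hAp (by positivity) hAt, ?_⟩
  refine (TreeBoundary.hajlaszSeminorm_le hK hν hε hp hθ0.le hf.aemeasurable).trans ?_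
  gcongr
  exact (ENNReal.rpow_le_rpow hBA (by positivity)).trans hAp
end
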